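/- Let N ≥ 2, 0 < p < N, m ≥ 1, and let B ⊂ ℝ^N be an open ball. There exists a constant C = C(B,p,N,m) > 0 such that for every multi-index α with |α| ≤ m and every u ∈ C_c^∞(B), ‖∂^α u‖_{h^p} ≤ C |B|^{(m−|α|)/N} Σ_{|β|=m} ‖∂^β u‖_{h^p}, where |B| is the Lebesgue measure of B. -/

import Mathlib

open MeasureTheory Set Metric Filter
open scoped ENNReal NNReal Topology

noncomputable section

abbrev RN (N : ℕ) := EuclideanSpace ℝ (Fin N)

variable {N : ℕ}

/-- Partial derivative in the `i`-th coordinate direction. -/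
def pd {E : Type*} [NormedAddCommGroup E] [NormedSpace ℝ E] (i : Fin N)
    (f : RN N → E) : RN N → E :=
  fun x => fderiv ℝ f x (EuclideanSpace.single i 1)

/-- Multi-index partial derivative `∂^α`. -/
def md {E : Type*} [NormedAddCommGroup E] [NormedSpace ℝ E] (α : Fin N → ℕ)
    (f : RN N → E) : RN N → E :=
  ((List.ofFn fun i : Fin N => (pd i)^[α i]).foldr (· ∘ ·) id) f

/-- Order `|α|` of a multi-index. -/
def mOrder (α : Fin N → ℕ) : ℕ := ∑ i, α i

/-- Multi-indices of order at most `k`. -/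
def idxLe (N k : ℕ) : Finset (Fin N → ℕ) :=
  (Fintype.piFinset fun _ : Fin N => Finset.range (k + 1)).filter fun α => mOrder α ≤ k

/-- Multi-indices of order exactly `k`. -/
def idxEq (N k : ℕ) : Finset (Fin N → ℕ) :=
  (Fintype.piFinset fun _ : Fin N => Finset.range (k + 1)).filter fun α => mOrder α = k

/-- The dilate `φ_t(z) = t^{-N} φ(z/t)`. -/
def dil (φ : RN N → ℝ) (t : ℝ) (z : RN N) : ℝ := φ (t⁻¹ • z) / t ^ N

/-- Convolution `(u * φ_t)(x)`. -/
def convAt (φ : RN N → ℝ) (t : ℝ) (u : RN N → ℂ) (x : RN N) : ℂ :=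
  ∫ y, dil φ t (x - y) • u y

/-- The small maximal function `sup_{0<t<1} |(u * φ_t)(x)|`. -/
def smallMax (φ : RN N → ℝ) (u : RN N → ℂ) (x : RN N) : ℝ≥0∞ :=
  ⨆ t ∈ Ioo (0 : ℝ) 1, ENNReal.ofReal ‖convAt φ t u x‖

/-- The localizable Hardy space quasi-norm `‖u‖_{h^p}` (for `0 < p < ∞`). -/
def hNorm (φ : RN N → ℝ) (p : ℝ) (u : RN N → ℂ) : ℝ≥0∞ :=
  (∫⁻ x, smallMax φ u x ^ p) ^ (1 / p)

/-- A fixed radial nonnegative smooth function supported in the unit ball with integral 1. -/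
structure GoodPhi (φ : RN N → ℝ) : Prop where
  smooth : ContDiff ℝ (⊤ : ℕ∞) φ
  nonneg : ∀ x, 0 ≤ φ x
  radial : ∀ x y : RN N, ‖x‖ = ‖y‖ → φ x = φ y
  supp : tsupport φ ⊆ closedBall 0 1
  int_one : ∫ x, φ x = 1

section LocalHardyEstimates

open scoped Convolution ContDiff

section Kernels

variable {F : Type} [NormedAddCommGroup F] [NormedSpace ℝ F]

lemma dil_contDiff {ψ : RN N → ℝ} (hψ : ContDiff ℝ ∞ ψ) (t : ℝ) : ContDiff ℝ ∞ (dil ψ t) := by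
  unfold dil
  exact (hψ.comp (contDiff_const_smul _)).div_const _

lemma dil_eq_zero {ψ : RN N → ℝ} (hs : tsupport ψ ⊆ closedBall 0 1) {t : ℝ} (ht : 0 < t)
    {z : RN N} (hz : t < ‖z‖) : dil ψ t z = 0 := by
  unfold dil
  rw [image_eq_zero_of_notMem_tsupport (f := ψ), zero_div]
  intro h
  have := hs h
  rw [mem_closedBall_zero_iff, norm_smul, norm_inv, Real.norm_of_nonneg ht.le,
    inv_mul_le_iff₀ ht] at this
  linarith

lemma dil_support {ψ : RN N → ℝ} (hs : tsupport ψ ⊆ closedBall 0 1) {t : ℝ} (ht : 0 < t) :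
    Function.support (dil ψ t) ⊆ ball 0 (2 * t) := by
  intro z hz
  rw [mem_ball_zero_iff]
  by_contra h
  exact hz (dil_eq_zero hs ht (by linarith))

lemma dil_hasCompactSupport {ψ : RN N → ℝ} (hs : tsupport ψ ⊆ closedBall 0 1) {t : ℝ}
    (ht : 0 < t) : HasCompactSupport (dil ψ t) :=
  HasCompactSupport.intro (isCompact_closedBall 0 t) fun z hz =>
    dil_eq_zero hs ht (by simpa using hz)

lemma dil_integral (ψ : RN N → ℝ) {t : ℝ} (ht : 0 < t) : ∫ z, dil ψ t z = ∫ z, ψ z := by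
  unfold dil
  rw [integral_div, Measure.integral_comp_inv_smul_of_nonneg _ _ ht.le]
  simp only [finrank_euclideanSpace, Fintype.card_fin, smul_eq_mul]
  field_simp

lemma dil_neg {φ : RN N → ℝ} (hφ : GoodPhi φ) (t : ℝ) (z : RN N) : dil φ t (-z) = dil φ t z := by
  unfold dil
  rw [hφ.radial (t⁻¹ • -z) (t⁻¹ • z) (by simp)]

lemma dil_nonneg {φ : RN N → ℝ} (hφ : GoodPhi φ) {t : ℝ} (ht : 0 < t) (z : RN N) :
    0 ≤ dil φ t z := div_nonneg (hφ.nonneg _) (by positivity)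

/-- Convolution with the dilated kernel, for functions with values in any normed space. -/
def smoothing (φ : RN N → ℝ) (t : ℝ) (h : RN N → F) : RN N → F :=
  dil φ t ⋆[ContinuousLinearMap.lsmul ℝ ℝ, volume] h

lemma smoothing_apply (φ : RN N → ℝ) (t : ℝ) (h : RN N → F) (x : RN N) :
    smoothing φ t h x = ∫ y, dil φ t (x - y) • h y := by
  unfold smoothing
  rw [convolution_eq_swap]
  rfl

lemma convAt_eq_smoothing (φ : RN N → ℝ) (t : ℝ) (u : RN N → ℂ) :
    convAt φ t u = smoothing φ t u := by
  ext x
  rw [smoothing_apply]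
  rfl

lemma smoothing_eq_zero {ψ : RN N → ℝ} (hs : tsupport ψ ⊆ closedBall 0 1) {t : ℝ} (ht : 0 < t)
    {g : RN N → F} {c : RN N} {r : ℝ} (hg : ∀ y, r < dist y c → g y = 0) {x : RN N}
    (hx : r + t < dist x c) : smoothing ψ t g x = 0 := by
  rw [smoothing_apply]
  refine integral_eq_zero_of_ae (Eventually.of_forall fun y => ?_)
  by_cases hy : r < dist y c
  · simp [hg y hy]
  · have : t < ‖x - y‖ := by
      rw [← dist_eq_norm]
      linarith [dist_triangle x y c]
    simp [dil_eq_zero hs ht this]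

section Smoothing

variable {ψ : RN N → ℝ} (hψ : ContDiff ℝ ∞ ψ) (hs : tsupport ψ ⊆ closedBall 0 1)
  {t : ℝ} (ht : 0 < t) {h : RN N → F} (hh : ContDiff ℝ ∞ h) (hc : HasCompactSupport h)

include hψ hh hc in
lemma smoothing_contDiff : ContDiff ℝ ∞ (smoothing ψ t h) :=
  hc.contDiff_convolution_right _ (dil_contDiff hψ t).continuous.locallyIntegrable hh

include hs ht hc in
lemma smoothing_hasCompactSupport : HasCompactSupport (smoothing ψ t h) :=
  (dil_hasCompactSupport hs ht).convolution _ hc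

include hψ hh hc in
lemma smoothing_hasFDerivAt (x : RN N) :
    HasFDerivAt (smoothing ψ t h) (smoothing ψ t (fderiv ℝ h) x) x := by
  exact hc.hasFDerivAt_convolution_right (μ := volume) (ContinuousLinearMap.lsmul ℝ ℝ)
    (dil_contDiff hψ t).continuous.locallyIntegrable (hh.of_le (mod_cast le_top)) x

end Smoothing

section Remainder

variable [CompleteSpace F] {φ : RN N → ℝ} (hφ : GoodPhi φ) {t : ℝ} (ht : 0 < t) {h : RN N → F}
  (hh : ContDiff ℝ ∞ h) (hc : HasCompactSupport h)

include hφ ht hh in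
lemma norm_sub_smoothing_le_of_dist {x : RN N} {ε : ℝ} (hε : 0 ≤ ε)
    (hb : ∀ y ∈ ball x (2 * t), ‖h y - h x‖ ≤ ε) : ‖h x - smoothing φ t h x‖ ≤ ε := by
  rw [← dist_eq_norm, dist_comm]
  refine dist_convolution_le hε (dil_support hφ.supp ht) (dil_nonneg hφ ht)
    ((dil_integral φ ht).trans hφ.int_one) hh.continuous.aestronglyMeasurable fun y hy => ?_
  rw [dist_eq_norm]
  exact hb y hy

include hφ ht hh in
lemma norm_sub_smoothing_le {c : ℝ} (hb : ∀ x, ‖h x‖ ≤ c) (x : RN N) :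
    ‖h x - smoothing φ t h x‖ ≤ 2 * c := by
  have h0 : 0 ≤ c := (norm_nonneg _).trans (hb x)
  refine norm_sub_smoothing_le_of_dist hφ ht hh (by positivity) fun y _ => ?_
  linarith [norm_sub_le (h y) (h x), hb x, hb y]

include hφ ht hh in
lemma norm_sub_smoothing_le_fderiv {c : ℝ} (hb : ∀ x, ‖fderiv ℝ h x‖ ≤ c) (x : RN N) :
    ‖h x - smoothing φ t h x‖ ≤ 2 * t * c := by
  have h0 : 0 ≤ c := (norm_nonneg _).trans (hb x)
  refine norm_sub_smoothing_le_of_dist hφ ht hh (by positivity) fun y hy => ?_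
  have h1 := convex_univ.norm_image_sub_le_of_norm_fderiv_le (𝕜 := ℝ) (f := h)
    (fun z _ => (hh.differentiable (by simp)) z) (fun z _ => hb z) (mem_univ x) (mem_univ y)
  rw [mem_ball, dist_eq_norm] at hy
  nlinarith

/-- The successive remainders `h_0 = g`, `h_{n+1} = h_n - φ_{2^{-(k+n)}} * h_n`. -/
def rem (φ : RN N → ℝ) (k : ℕ) (g : RN N → F) : ℕ → RN N → F
  | 0 => g
  | n + 1 => rem φ k g n - smoothing φ ((1 / 2) ^ (k + n)) (rem φ k g n)

omit [CompleteSpace F] in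
include hφ hh hc in
lemma rem_contDiff_hasCompactSupport (k n : ℕ) :
    ContDiff ℝ ∞ (rem φ k h n) ∧ HasCompactSupport (rem φ k h n) := by
  induction n with
  | zero => exact ⟨hh, hc⟩
  | succ n ih =>
    exact ⟨ih.1.sub (smoothing_contDiff hφ.smooth ih.1 ih.2),
      ih.2.sub (smoothing_hasCompactSupport hφ.supp (by positivity) ih.2)⟩

omit [CompleteSpace F] in
include hφ hh hc in
lemma fderiv_rem (k n : ℕ) : fderiv ℝ (rem φ k h n) = rem φ k (fderiv ℝ h) n := by
  induction n with
  | zero => rfl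
  | succ n ih =>
    obtain ⟨h1, h2⟩ := rem_contDiff_hasCompactSupport hφ hh hc k n
    ext1 x
    have h3 := (((h1.differentiable (by simp)) x).hasFDerivAt.sub
      (smoothing_hasFDerivAt (t := (1 / 2) ^ (k + n)) hφ.smooth h1 h2 x)).fderiv
    rw [ih] at h3
    exact h3

omit [CompleteSpace F] in
include hφ in
lemma rem_eq_zero {g : RN N → F} {c : RN N} {r : ℝ} (hg : ∀ y, r < dist y c → g y = 0)
    (k n : ℕ) (y : RN N) (hy : r + 2 * (1 / 2) ^ k * (1 - (1 / 2) ^ n) < dist y c) :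
    rem φ k g n y = 0 := by
  induction n generalizing y with
  | zero => exact hg y (by simpa using hy)
  | succ n ih =>
    have h0 : (0 : ℝ) < (1 / 2) ^ (k + n) := by positivity
    have h1 : 2 * (1 / 2 : ℝ) ^ k * (1 - (1 / 2) ^ (n + 1))
        = 2 * (1 / 2) ^ k * (1 - (1 / 2) ^ n) + (1 / 2) ^ (k + n) := by ring
    have h2 := ih y (by linarith)
    have h3 := smoothing_eq_zero (t := (1 / 2) ^ (k + n)) hφ.supp h0 (g := rem φ k g n) ih
      (by linarith : _ < dist y c)
    rw [rem, Pi.sub_apply, h2, h3, sub_zero]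

include hφ in
lemma rem_bound (L : ℕ) : ∃ K : ℝ, 1 ≤ K ∧ ∀ (k : ℕ) (F : Type) [NormedAddCommGroup F]
    [NormedSpace ℝ F] [CompleteSpace F] (g : RN N → F) (c : ℝ), ContDiff ℝ ∞ g →
    HasCompactSupport g → (∀ a ≤ L, ∀ x, ‖iteratedFDeriv ℝ a g x‖ ≤ c * 2 ^ (k * a)) →
    ∀ n x, ‖rem φ k g n x‖ ≤ K * 2 ^ n * (1 / 2) ^ (L * n) * c := by
  induction L with
  | zero =>
    refine ⟨1, le_rfl, fun k F _ _ _ g c hg hgc hb n => ?_⟩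
    induction n with
    | zero => intro x; simpa [rem] using hb 0 le_rfl x
    | succ n ih =>
      intro x
      have h1 := norm_sub_smoothing_le hφ (t := (1 / 2) ^ (k + n)) (by positivity)
        (rem_contDiff_hasCompactSupport hφ hg hgc k n).1 ih x
      refine h1.trans (le_of_eq ?_)
      ring
  | succ L ih =>
    obtain ⟨K, hK, ih⟩ := ih
    refine ⟨2 ^ (L + 1) * K, one_le_mul_of_one_le_of_one_le (one_le_pow₀ one_le_two) hK,
      fun k F _ _ _ g c hg hgc hb n x => ?_⟩
    have hc0 : ‖g x‖ ≤ c := by simpa using hb 0 (Nat.zero_le _) x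
    cases n with
    | zero =>
      have h0 : 0 ≤ c := (norm_nonneg _).trans hc0
      have h1 : 1 ≤ 2 ^ (L + 1) * K :=
        one_le_mul_of_one_le_of_one_le (one_le_pow₀ one_le_two) hK
      simp only [rem, pow_zero, mul_zero, mul_one]
      nlinarith
    | succ n =>
      have h2 := ih k _ (fderiv ℝ g) (c * 2 ^ k) (hg.fderiv_right (by simp)) (hgc.fderiv ℝ)
        (fun a ha y => by
          rw [norm_iteratedFDeriv_fderiv]
          refine (hb (a + 1) (by omega) y).trans (le_of_eq ?_)
          ring) n
      rw [← fderiv_rem hφ hg hgc] at h2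
      refine (norm_sub_smoothing_le_fderiv hφ (t := (1 / 2) ^ (k + n)) (by positivity)
        (rem_contDiff_hasCompactSupport hφ hg hgc k n).1 h2 x).trans (le_of_eq ?_)
      have e1 : (2 : ℝ) ^ n * (1 / 2) ^ n = 1 := by rw [← mul_pow]; norm_num
      have e2 : (2 : ℝ) ^ k * (1 / 2) ^ k = 1 := by rw [← mul_pow]; norm_num
      have e3 : (2 : ℝ) ^ L * (1 / 2) ^ L = 1 := by rw [← mul_pow]; norm_num
      have e4 : (1 / 2 : ℝ) ^ ((L + 1) * (n + 1)) =
        (1 / 2) ^ (L * n) * (1 / 2) ^ n * (1 / 2) ^ L * (1 / 2) := by ring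
      rw [e4]
      calc 2 * (1 / 2 : ℝ) ^ (k + n) * (K * 2 ^ n * (1 / 2) ^ (L * n) * (c * 2 ^ k))
          = 2 * K * (1 / 2) ^ (L * n) * c * (2 ^ n * (1 / 2) ^ n) * (2 ^ k * (1 / 2) ^ k) := by
            ring
        _ = 2 * K * (1 / 2) ^ (L * n) * c * (2 ^ n * (1 / 2) ^ n) * (2 ^ L * (1 / 2) ^ L) := by
            rw [e2, e3]
        _ = _ := by ring

end Remainder

section Pairing

variable {φ : RN N → ℝ} (hφ : GoodPhi φ) {g : RN N → ℝ} (hg : ContDiff ℝ ∞ g)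
  (hgc : HasCompactSupport g) {f : RN N → ℂ} (hf : ContDiff ℝ ∞ f) (hfc : HasCompactSupport f)

include hφ hg hgc hf hfc in
lemma integral_smoothing_smul (t : ℝ) :
    ∫ y, smoothing φ t g y • f y = ∫ y, g y • smoothing φ t f y := by
  simp_rw [smoothing_apply, ← integral_smul_const, ← integral_smul]
  rw [integral_integral_swap]
  · refine integral_congr_ae (Eventually.of_forall fun z => ?_)
    refine integral_congr_ae (Eventually.of_forall fun y => ?_)
    simp only [smul_smul, smul_eq_mul]
    rw [← neg_sub z y, dil_neg hφ, mul_comm]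
  · refine Continuous.integrable_of_hasCompactSupport ?_ ?_
    · have := (dil_contDiff hφ.smooth t).continuous
      have := hg.continuous
      have := hf.continuous
      simp only [Function.uncurry_def]
      fun_prop
    · refine HasCompactSupport.intro (hfc.isCompact.prod hgc.isCompact) fun q hq => ?_
      rw [mem_prod, not_and_or] at hq
      rcases hq with hq | hq
      · simp [Function.uncurry_def, image_eq_zero_of_notMem_tsupport hq]
      · simp [Function.uncurry_def, image_eq_zero_of_notMem_tsupport hq]

lemma integrable_smul_of_compact (hg : ContDiff ℝ ∞ g) (hgc : HasCompactSupport g)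
    (hf : ContDiff ℝ ∞ f) : Integrable fun y => g y • f y :=
  (hg.continuous.smul hf.continuous).integrable_of_hasCompactSupport (hgc.smul_right (f' := f))

include hφ hg hgc hf hfc in
lemma integral_smul_eq_sum_rem (k M : ℕ) :
    ∫ y, g y • f y = (∑ n ∈ Finset.range M,
      ∫ y, rem φ k g n y • smoothing φ ((1 / 2) ^ (k + n)) f y) + ∫ y, rem φ k g M y • f y := by
  induction M with
  | zero => simp [rem]
  | succ M ih =>
    obtain ⟨h1, h2⟩ := rem_contDiff_hasCompactSupport hφ hg hgc k M
    have ht : (0 : ℝ) < (1 / 2) ^ (k + M) := by positivity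
    rw [ih, Finset.sum_range_succ, add_assoc, ← integral_smoothing_smul hφ h1 h2 hf hfc,
      ← integral_add (integrable_smul_of_compact (smoothing_contDiff hφ.smooth h1 h2)
        (smoothing_hasCompactSupport hφ.supp ht h2) hf)
        (integrable_smul_of_compact (rem_contDiff_hasCompactSupport hφ hg hgc k (M + 1)).1
          (rem_contDiff_hasCompactSupport hφ hg hgc k (M + 1)).2 hf)]
    congr 2
    ext1 y
    simp [rem, sub_smul]

end Pairing

end Kernels

/-- The weighted sum of local averages of `|φ_{2^{-(k+n)}} * f|`, `n ≥ 0`, over the ball of radius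
`5 * 2^{-k}` around `x`. -/
def tailAvg (φ : RN N → ℝ) (L : ℕ) (f : RN N → ℂ) (k : ℕ) (x : RN N) : ℝ≥0∞ :=
  ∑' n : ℕ, 2⁻¹ ^ (L * n) * 2 ^ (k * N) *
    ∫⁻ y in closedBall x (5 * (1 / 2) ^ k), ‖smoothing φ ((1 / 2) ^ (k + n)) f y‖ₑ

section KernelBound

lemma exists_iteratedFDeriv_bound {ψ : RN N → ℝ} (hψ : ContDiff ℝ ∞ ψ) (hc : HasCompactSupport ψ)
    (L : ℕ) : ∃ K : ℝ, 0 < K ∧ ∀ a ≤ L, ∀ x, ‖iteratedFDeriv ℝ a ψ x‖ ≤ K := by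
  have h1 : ∀ a : ℕ, ∃ K : ℝ, ∀ x, ‖iteratedFDeriv ℝ a ψ x‖ ≤ K := fun a =>
    (hψ.continuous_iteratedFDeriv (mod_cast le_top)).bounded_above_of_compact_support
      (hc.iteratedFDeriv a)
  choose K hK using h1
  refine ⟨1 + ∑ a ∈ Finset.range (L + 1), |K a|, by positivity, fun a ha x => ?_⟩
  have h2 := Finset.single_le_sum (f := fun a => |K a|) (fun i _ => abs_nonneg _)
    (Finset.mem_range.2 (Nat.lt_succ_of_le ha))
  linarith [hK a x, le_abs_self (K a)]

lemma norm_iteratedFDeriv_dil_sub {ψ : RN N → ℝ} (hψ : ContDiff ℝ ∞ ψ) {s : ℝ} (hs : 0 < s)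
    (z y : RN N) (a : ℕ) : ‖iteratedFDeriv ℝ a (fun y => dil ψ s (z - y)) y‖ =
      s⁻¹ ^ N * s⁻¹ ^ a * ‖iteratedFDeriv ℝ a ψ (s⁻¹ • (z - y))‖ := by
  have h1 : (fun y => dil ψ s (z - y)) =
      fun y => (s⁻¹ ^ N) • (fun w => ψ ((-s⁻¹) • w)) (y - z) := by
    ext y
    simp only [dil, smul_eq_mul, div_eq_inv_mul, inv_pow]
    congr 2
    rw [neg_smul, ← smul_neg, neg_sub]
  have h2 : ContDiff ℝ a fun w => ψ ((-s⁻¹) • w) :=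
    (hψ.of_le (mod_cast le_top)).comp (contDiff_const_smul _)
  have h3 : ContDiffAt ℝ a (fun y => (fun w => ψ ((-s⁻¹) • w)) (y - z)) y :=
    (h2.comp (contDiff_id.sub contDiff_const)).contDiffAt
  rw [h1, iteratedFDeriv_const_smul_apply' h3,
    iteratedFDeriv_comp_sub (f := fun w => ψ ((-s⁻¹) • w)), iteratedFDeriv_comp_const_smul _ (hψ.of_le (mod_cast le_top)),
    norm_smul, norm_smul, mul_assoc, neg_smul, ← smul_neg, neg_sub]
  simp [abs_of_pos hs]

lemma norm_smoothing_le_tailAvg {φ : RN N → ℝ} (hφ : GoodPhi φ) {ψ : RN N → ℝ}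
    (hψ : ContDiff ℝ ∞ ψ) (hψs : tsupport ψ ⊆ closedBall 0 1) {L : ℕ} (hL : 1 ≤ L) :
    ∃ C : ℝ≥0∞, C ≠ ⊤ ∧ ∀ (k : ℕ) (s : ℝ), (1 / 2) ^ k ≤ s → s ≤ 2 * (1 / 2) ^ k →
      ∀ f : RN N → ℂ, ContDiff ℝ ∞ f → HasCompactSupport f →
      ∀ x z : RN N, dist z x ≤ (1 / 2) ^ k → ‖smoothing ψ s f z‖ₑ ≤ C * tailAvg φ L f k x := by
  obtain ⟨K, hK1, hK⟩ := rem_bound hφ (L + 1)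
  obtain ⟨A, hA0, hA⟩ := exists_iteratedFDeriv_bound hψ
    ((isCompact_closedBall 0 1).of_isClosed_subset (isClosed_tsupport ψ) hψs) (L + 1)
  have hK0 : 0 < K := by linarith
  refine ⟨ENNReal.ofReal (K * A), ENNReal.ofReal_ne_top, fun k s hs1 hs2 f hf hfc x z hzx => ?_⟩
  have hk0 : (0 : ℝ) < (1 / 2) ^ k := by positivity
  have hs : 0 < s := hk0.trans_le hs1
  set g : RN N → ℝ := fun y => dil ψ s (z - y) with hgdef
  have hg : ContDiff ℝ ∞ g := (dil_contDiff hψ s).comp (contDiff_const.sub contDiff_id)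
  have hgc : HasCompactSupport g :=
    (dil_hasCompactSupport hψs hs).comp_homeomorph (Homeomorph.subLeft z)
  have hg0 : ∀ y, 3 * (1 / 2) ^ k < dist y x → g y = 0 := fun y hy => by
    refine dil_eq_zero hψs hs ?_
    rw [← dist_eq_norm]
    linarith [dist_triangle y z x, dist_comm y z]
  have hsinv : s⁻¹ ≤ 2 ^ k := by
    rw [inv_le_comm₀ hs (by positivity)]
    simpa using hs1
  have hgb : ∀ a ≤ L + 1, ∀ y, ‖iteratedFDeriv ℝ a g y‖ ≤ (A * 2 ^ (k * N)) * 2 ^ (k * a) := by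
    intro a ha y
    rw [hgdef, norm_iteratedFDeriv_dil_sub hψ hs, pow_mul, pow_mul]
    have := hA a ha (s⁻¹ • (z - y))
    calc _ ≤ ((2 : ℝ) ^ k) ^ N * (2 ^ k) ^ a * A := by gcongr
      _ = _ := by ring
  have hrem : ∀ n y, ‖rem φ k g n y‖ ≤ K * A * (1 / 2) ^ (L * n) * 2 ^ (k * N) := by
    intro n y
    refine (hK k ℝ g _ hg hgc hgb n y).trans (le_of_eq ?_)
    have e1 : (2 : ℝ) ^ n * (1 / 2) ^ n = 1 := by rw [← mul_pow]; norm_num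
    calc _ = (2 ^ n * (1 / 2) ^ n) * (K * A * (1 / 2) ^ (L * n) * 2 ^ (k * N)) := by ring
      _ = _ := by rw [e1, one_mul]
  have hreme : ∀ n y, ‖rem φ k g n y‖ₑ ≤
      ENNReal.ofReal (K * A) * (2⁻¹ ^ (L * n) * 2 ^ (k * N)) := by
    intro n y
    rw [← ofReal_norm]
    refine (ENNReal.ofReal_le_ofReal (hrem n y)).trans (le_of_eq ?_)
    have e : ENNReal.ofReal ((1 / 2) ^ (L * n) * 2 ^ (k * N)) = 2⁻¹ ^ (L * n) * 2 ^ (k * N) := by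
      rw [ENNReal.ofReal_mul (by positivity), ENNReal.ofReal_pow (by positivity),
        ENNReal.ofReal_pow (by positivity), one_div, ENNReal.ofReal_inv_of_pos two_pos]
      norm_num
    rw [mul_assoc (K * A), ENNReal.ofReal_mul (mul_pos hK0 hA0).le, e]
  have hterm : ∀ n, ‖∫ y, rem φ k g n y • smoothing φ ((1 / 2) ^ (k + n)) f y‖ₑ ≤
      ENNReal.ofReal (K * A) * (2⁻¹ ^ (L * n) * 2 ^ (k * N) *
        ∫⁻ y in closedBall x (5 * (1 / 2) ^ k), ‖smoothing φ ((1 / 2) ^ (k + n)) f y‖ₑ) := by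
    intro n
    refine (enorm_integral_le_lintegral_enorm _).trans ?_
    rw [← mul_assoc, ← lintegral_const_mul' _ _ (by finiteness),
      ← lintegral_indicator measurableSet_closedBall]
    refine lintegral_mono fun y => ?_
    by_cases hy : y ∈ closedBall x (5 * (1 / 2) ^ k)
    · rw [indicator_of_mem hy, enorm_smul]
      gcongr
      exact hreme n y
    · rw [rem_eq_zero hφ hg0 k n y]
      · simp
      · rw [mem_closedBall, not_le] at hy
        have : (0 : ℝ) < (1 / 2) ^ n := by positivity
        nlinarith
  have hbound : ∀ M, ‖smoothing ψ s f z‖ₑ ≤ ENNReal.ofReal (K * A) * tailAvg φ L f k x +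
      ENNReal.ofReal (K * A) * (2⁻¹ ^ M * 2 ^ (k * N)) * ∫⁻ y, ‖f y‖ₑ := by
    intro M
    rw [smoothing_apply, integral_smul_eq_sum_rem hφ hg hgc hf hfc k M]
    refine (enorm_add_le _ _).trans (add_le_add ?_ ?_)
    · refine (enorm_sum_le _ _).trans ((Finset.sum_le_sum fun n _ => hterm n).trans ?_)
      rw [← Finset.mul_sum]
      gcongr
      exact ENNReal.sum_le_tsum _
    · refine (enorm_integral_le_lintegral_enorm _).trans ?_
      rw [← lintegral_const_mul' _ _ (by finiteness)]
      refine lintegral_mono fun y => ?_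
      rw [enorm_smul]
      gcongr
      refine (hreme M y).trans ?_
      gcongr _ * (?_ * _)
      exact pow_le_pow_of_le_one zero_le (by norm_num) (Nat.le_mul_of_pos_left _ hL)
  have hfi : ∫⁻ y, ‖f y‖ₑ ≠ ⊤ :=
    (hf.continuous.integrable_of_hasCompactSupport hfc).hasFiniteIntegral.ne
  have hlim : Tendsto (fun M : ℕ => ENNReal.ofReal (K * A) * tailAvg φ L f k x +
      ENNReal.ofReal (K * A) * (2⁻¹ ^ M * 2 ^ (k * N)) * ∫⁻ y, ‖f y‖ₑ) atTop
      (𝓝 (ENNReal.ofReal (K * A) * tailAvg φ L f k x +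
        ENNReal.ofReal (K * A) * (0 * 2 ^ (k * N)) * ∫⁻ y, ‖f y‖ₑ)) := by
    refine Tendsto.const_add _ (ENNReal.Tendsto.mul_const (ENNReal.Tendsto.const_mul
      (ENNReal.Tendsto.mul_const ?_ (Or.inr (by finiteness))) (Or.inr (by finiteness)))
      (Or.inr hfi))
    exact ENNReal.tendsto_pow_atTop_nhds_zero_of_lt_one (by norm_num)
  have := ge_of_tendsto' hlim hbound
  simpa using this

end KernelBound

section ENNRealInequalities

lemma ennreal_tsum_rpow_le {p : ℝ} (hp0 : 0 < p) (hp1 : p ≤ 1) (a : ℕ → ℝ≥0∞) :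
    (∑' n, a n) ^ p ≤ ∑' n, a n ^ p := by
  have h1 : ∀ M : ℕ, (∑ n ∈ Finset.range M, a n) ^ p ≤ ∑ n ∈ Finset.range M, a n ^ p := by
    intro M
    induction M with
    | zero => simp [hp0]
    | succ M ih =>
      rw [Finset.sum_range_succ, Finset.sum_range_succ]
      exact (ENNReal.rpow_add_le_add_rpow _ _ hp0.le hp1).trans (by gcongr)
  refine le_of_tendsto' ((ENNReal.continuous_rpow_const.tendsto _).comp
    ENNReal.summable.hasSum.tendsto_sum_nat) fun M => ?_
  exact (h1 M).trans (ENNReal.sum_le_tsum _)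

lemma ennreal_rpow_mul_rpow_le {p : ℝ} (hp0 : 0 < p) (hp1 : p < 1) {δ : ℝ≥0∞} (hδ0 : δ ≠ 0)
    (hδ : δ ≠ ⊤) (a b : ℝ≥0∞) :
    a ^ (1 - p) * b ^ p ≤ δ ^ p * a + δ⁻¹ ^ (1 - p) * b := by
  have hq : 0 ≤ 1 - p := by linarith
  have hsum : ∀ c : ℝ≥0∞, c ^ (1 - p) * c ^ p = c := fun c => by
    rw [← ENNReal.rpow_add_of_nonneg _ _ hq hp0.le]
    simp
  rcases le_total b (δ * a) with h | h
  · refine le_add_right ?_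
    calc a ^ (1 - p) * b ^ p ≤ a ^ (1 - p) * (δ * a) ^ p := by gcongr
      _ = δ ^ p * (a ^ (1 - p) * a ^ p) := by
        rw [ENNReal.mul_rpow_of_nonneg _ _ hp0.le]; ring
      _ = _ := by rw [hsum]
  · refine le_add_left ?_
    have h2 : a ≤ δ⁻¹ * b := by
      rw [mul_comm, ← div_eq_mul_inv, ENNReal.le_div_iff_mul_le (Or.inl hδ0) (Or.inl hδ), mul_comm]
      exact h
    calc a ^ (1 - p) * b ^ p ≤ (δ⁻¹ * b) ^ (1 - p) * b ^ p := by gcongr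
      _ = δ⁻¹ ^ (1 - p) * (b ^ (1 - p) * b ^ p) := by
        rw [ENNReal.mul_rpow_of_nonneg _ _ hq]; ring
      _ = _ := by rw [hsum]

lemma lintegral_rpow_le_of_rpow_le {X : Type*} [MeasurableSpace X] {μ : Measure X} {B : Set X}
    (hB : MeasurableSet B) {p : ℝ} (hp0 : 0 < p) (hp1 : p < 1) {S : X → ℝ≥0∞} (hS : Measurable S)
    {a : ℝ≥0∞} (ha : ∀ y ∈ B, S y ^ p ≤ a) :
    (∫⁻ y in B, S y ∂μ) ^ p ≤ a ^ (1 - p) * (∫⁻ y in B, S y ^ p ∂μ) ^ p := by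
  have hq : 0 ≤ (1 - p) / p := div_nonneg (by linarith) hp0.le
  have h1 : ∫⁻ y in B, S y ∂μ ≤ a ^ ((1 - p) / p) * ∫⁻ y in B, S y ^ p ∂μ := by
    rw [← lintegral_const_mul _ (hS.pow_const p)]
    refine setLIntegral_mono' hB fun y hy => ?_
    calc S y = (S y ^ p) ^ ((1 - p) / p) * S y ^ p := by
          rw [← ENNReal.rpow_mul, mul_div_cancel₀ _ hp0.ne',
            ← ENNReal.rpow_add_of_nonneg _ _ (by linarith) hp0.le]
          simp
      _ ≤ _ := by gcongr; exact ha y hy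
  calc _ ≤ (a ^ ((1 - p) / p) * ∫⁻ y in B, S y ^ p ∂μ) ^ p := by gcongr
    _ = _ := by
      rw [ENNReal.mul_rpow_of_nonneg _ _ hp0.le, ← ENNReal.rpow_mul, div_mul_cancel₀ _ hp0.ne']

end ENNRealInequalities

section Balls

lemma volume_closedBall_RN (x : RN N) {r : ℝ} (hr : 0 ≤ r) :
    volume (closedBall x r) = ENNReal.ofReal r ^ N * volume (ball (0 : RN N) 1) := by
  rw [Measure.addHaar_closedBall _ _ hr, ENNReal.ofReal_pow hr]
  simp

lemma lintegral_closedBall_eq_indicator (F : RN N → ℝ≥0∞) (x : RN N) (r : ℝ) :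
    ∫⁻ y in closedBall x r, F y =
      ∫⁻ y, {q : RN N × RN N | dist q.2 q.1 ≤ r}.indicator (fun q => F q.2) (x, y) := by
  rw [← lintegral_indicator measurableSet_closedBall]
  rfl

lemma measurable_indicator_dist {F : RN N → ℝ≥0∞} (hF : Measurable F) (r : ℝ) :
    Measurable ({q : RN N × RN N | dist q.2 q.1 ≤ r}.indicator fun q => F q.2) :=
  (hF.comp measurable_snd).indicator
    (isClosed_le (continuous_snd.dist continuous_fst) continuous_const).measurableSet

lemma measurable_lintegral_closedBall {F : RN N → ℝ≥0∞} (hF : Measurable F) (r : ℝ) :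
    Measurable fun x => ∫⁻ y in closedBall x r, F y := by
  simp_rw [lintegral_closedBall_eq_indicator]
  exact (measurable_indicator_dist hF r).lintegral_prod_right'

lemma lintegral_lintegral_closedBall {F : RN N → ℝ≥0∞} (hF : Measurable F) {r : ℝ} (hr : 0 ≤ r) :
    ∫⁻ x, ∫⁻ y in closedBall x r, F y =
      ENNReal.ofReal r ^ N * volume (ball (0 : RN N) 1) * ∫⁻ y, F y := by
  simp_rw [lintegral_closedBall_eq_indicator]
  rw [lintegral_lintegral_swap (μ := volume) (ν := volume) (f := fun x y =>
      {q : RN N × RN N | dist q.2 q.1 ≤ r}.indicator (fun q => F q.2) (x, y))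
      (measurable_indicator_dist hF r).aemeasurable,
    ← lintegral_const_mul _ hF]
  refine lintegral_congr fun y => ?_
  have : (fun x => {q : RN N × RN N | dist q.2 q.1 ≤ r}.indicator (fun q => F q.2) (x, y)) =
      (closedBall y r).indicator fun _ => F y := by
    ext x
    simp only [indicator, mem_ofPred_eq, mem_closedBall, dist_comm]
  rw [this, lintegral_indicator measurableSet_closedBall, setLIntegral_const,
    volume_closedBall_RN y hr, mul_comm]

end Balls

section TailAverage

variable {φ : RN N → ℝ} (hφ : GoodPhi φ) {f : RN N → ℂ} (hf : ContDiff ℝ ∞ f)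
  (hfc : HasCompactSupport f)

include hφ hf hfc in
lemma measurable_enorm_smoothing (t : ℝ) : Measurable fun y => ‖smoothing φ t f y‖ₑ :=
  (smoothing_contDiff hφ.smooth hf hfc).continuous.measurable.enorm

include hφ hf hfc in
lemma measurable_tailAvg (L k : ℕ) : Measurable (tailAvg φ L f k) :=
  Measurable.tsum fun _ =>
    (measurable_lintegral_closedBall (measurable_enorm_smoothing hφ hf hfc _) _).const_mul _

lemma ofReal_half_pow (k : ℕ) : ENNReal.ofReal ((1 / 2) ^ k) = 2⁻¹ ^ k := by
  rw [ENNReal.ofReal_pow (by positivity), one_div, ENNReal.ofReal_inv_of_pos two_pos]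
  norm_num

lemma two_pow_mul_half_pow (k : ℕ) : (2 : ℝ≥0∞) ^ k * 2⁻¹ ^ k = 1 := by
  rw [← mul_pow, ENNReal.mul_inv_cancel (by simp) (by simp), one_pow]

lemma two_pow_mul_ofReal_pow (k : ℕ) {c : ℝ} (hc : 0 ≤ c) :
    (2 : ℝ≥0∞) ^ (k * N) * ENNReal.ofReal (c * (1 / 2) ^ k) ^ N = ENNReal.ofReal c ^ N := by
  rw [ENNReal.ofReal_mul hc, ofReal_half_pow, mul_pow, pow_mul,
    mul_left_comm, ← mul_pow, two_pow_mul_half_pow, one_pow, mul_one]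

lemma tsum_half_pow : ∑' n : ℕ, (2⁻¹ : ℝ≥0∞) ^ n = 2 := by
  rw [ENNReal.tsum_geometric, ENNReal.one_sub_inv_two, inv_inv]

include hφ hf hfc in
lemma enorm_smoothing_rpow_mul_le {p : ℝ} (hp0 : 0 < p) {L : ℕ} {C : ℝ≥0∞}
    (hC : ∀ (k : ℕ), ∀ x z : RN N, dist z x ≤ (1 / 2) ^ k →
      ‖smoothing φ ((1 / 2) ^ k) f z‖ₑ ≤ C * tailAvg φ L f k x) (j : ℕ) (y : RN N) :
    2⁻¹ ^ (j * N) * volume (ball (0 : RN N) 1) * ‖smoothing φ ((1 / 2) ^ j) f y‖ₑ ^ p ≤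
      C ^ p * ∫⁻ w in closedBall y ((1 / 2) ^ j), tailAvg φ L f j w ^ p := by
  have h1 : volume (closedBall y ((1 / 2) ^ j)) =
      2⁻¹ ^ (j * N) * volume (ball (0 : RN N) 1) := by
    rw [volume_closedBall_RN y (by positivity), ofReal_half_pow, pow_mul]
  rw [← h1, mul_comm, ← setLIntegral_const,
    ← lintegral_const_mul _ ((measurable_tailAvg hφ hf hfc L j).pow_const p)]
  refine setLIntegral_mono' measurableSet_closedBall fun w hw => ?_
  rw [← ENNReal.mul_rpow_of_nonneg _ _ hp0.le]
  gcongr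
  exact hC j w y (by rwa [dist_comm])

include hφ hf hfc in
lemma tailAvg_rpow_le {p : ℝ} (hp0 : 0 < p) (hp1 : p < 1) {L : ℕ} {C : ℝ≥0∞}
    (hC : ∀ (k : ℕ), ∀ x z : RN N, dist z x ≤ (1 / 2) ^ k →
      ‖smoothing φ ((1 / 2) ^ k) f z‖ₑ ≤ C * tailAvg φ L f k x)
    {δ : ℝ≥0∞} (hδ0 : δ ≠ 0) (hδ : δ ≠ ⊤) (k : ℕ) (x : RN N) :
    tailAvg φ L f k x ^ p ≤ ∑' n : ℕ, (2⁻¹ ^ (L * n)) ^ p *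
      (δ ^ p * (2 ^ ((k + n) * N) * (volume (ball (0 : RN N) 1))⁻¹ * (C ^ p *
          ∫⁻ w in closedBall x (6 * (1 / 2) ^ k), tailAvg φ L f (k + n) w ^ p)) +
        δ⁻¹ ^ (1 - p) * (2 ^ (k * N) * ∫⁻ y in closedBall x (5 * (1 / 2) ^ k),
          ‖smoothing φ ((1 / 2) ^ (k + n)) f y‖ₑ ^ p)) := by
  refine (ennreal_tsum_rpow_le hp0 hp1.le _).trans (ENNReal.tsum_le_tsum fun n => ?_)
  rw [mul_assoc, ENNReal.mul_rpow_of_nonneg _ _ hp0.le]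
  gcongr
  set w₀ := volume (ball (0 : RN N) 1) with hw₀
  have hw₀0 : w₀ ≠ 0 := (measure_ball_pos _ _ one_pos).ne'
  have hw₀1 : w₀ ≠ ⊤ := measure_ball_lt_top.ne
  refine le_trans ?_ (ennreal_rpow_mul_rpow_le hp0 hp1 hδ0 hδ _ _)
  rw [ENNReal.mul_rpow_of_nonneg _ _ hp0.le, ENNReal.mul_rpow_of_nonneg _ _ hp0.le,
    mul_left_comm]
  gcongr
  refine lintegral_rpow_le_of_rpow_le measurableSet_closedBall hp0 hp1
    (measurable_enorm_smoothing hφ hf hfc _) fun y hy => ?_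
  have h1 := enorm_smoothing_rpow_mul_le hφ hf hfc hp0 hC (k + n) y
  have h2 : closedBall y ((1 / 2) ^ (k + n)) ⊆ closedBall x (6 * (1 / 2) ^ k) := by
    refine closedBall_subset_closedBall' ?_
    have : (1 / 2 : ℝ) ^ (k + n) ≤ (1 / 2) ^ k :=
      pow_le_pow_of_le_one (by norm_num) (by norm_num) (by omega)
    rw [mem_closedBall] at hy
    linarith
  calc ‖smoothing φ ((1 / 2) ^ (k + n)) f y‖ₑ ^ p
      = 2 ^ ((k + n) * N) * w₀⁻¹ * (2⁻¹ ^ ((k + n) * N) * w₀ *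
          ‖smoothing φ ((1 / 2) ^ (k + n)) f y‖ₑ ^ p) := by
        have e : (2 : ℝ≥0∞) ^ ((k + n) * N) * w₀⁻¹ * (2⁻¹ ^ ((k + n) * N) * w₀) = 1 := by
          rw [mul_mul_mul_comm, two_pow_mul_half_pow, ENNReal.inv_mul_cancel hw₀0 hw₀1, one_mul]
        rw [← mul_assoc, e, one_mul]
    _ ≤ _ := by
        refine mul_le_mul_right (h1.trans ?_) _
        gcongr

end TailAverage

section TailAverageIntegral

variable {φ : RN N → ℝ} (hφ : GoodPhi φ) {f : RN N → ℂ} (hf : ContDiff ℝ ∞ f)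
  (hfc : HasCompactSupport f)

lemma enorm_smoothing_le_smallMax {t : ℝ} (ht : t ∈ Ioo (0 : ℝ) 1) (φ : RN N → ℝ) (f : RN N → ℂ)
    (x : RN N) : ‖smoothing φ t f x‖ₑ ≤ smallMax φ f x := by
  rw [← convAt_eq_smoothing, ← ofReal_norm]
  exact le_iSup₂_of_le t ht le_rfl

include hφ hf hfc in
lemma exists_lintegral_tailAvg_bound {p : ℝ} (hp0 : 0 < p) {L : ℕ} (hL : 1 ≤ L) :
    ∃ M : ℝ≥0∞, M ≠ ⊤ ∧ ∀ k, ∫⁻ x, tailAvg φ L f k x ^ p ≤ M := by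
  obtain ⟨c, hc⟩ := hfc.exists_bound_of_continuous hf.continuous
  obtain ⟨R, hR⟩ := hfc.isBounded.subset_closedBall (0 : RN N)
  have hf0 : ∀ y, R < dist y 0 → f y = 0 := fun y hy =>
    image_eq_zero_of_notMem_tsupport fun h => by
      have := hR h
      rw [mem_closedBall] at this
      linarith
  set vb := volume (ball (0 : RN N) 1)
  have hvb : vb ≠ ⊤ := measure_ball_lt_top.ne
  have hS : ∀ (j : ℕ) y, ‖smoothing φ ((1 / 2) ^ j) f y‖ₑ ≤ ENNReal.ofReal (3 * c) := by
    intro j y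
    rw [← ofReal_norm]
    refine ENNReal.ofReal_le_ofReal ?_
    have h1 := norm_sub_smoothing_le hφ (t := (1 / 2) ^ j) (by positivity) hf hc y
    have h2 := norm_sub_norm_le (smoothing φ ((1 / 2) ^ j) f y) (f y)
    rw [norm_sub_rev] at h2
    linarith [hc y]
  have hle : ∀ k x, tailAvg φ L f k x ≤
      2 * (ENNReal.ofReal 5 ^ N * vb * ENNReal.ofReal (3 * c)) := by
    intro k x
    rw [← tsum_half_pow, ← ENNReal.tsum_mul_right]
    refine ENNReal.tsum_le_tsum fun n => ?_
    rw [mul_assoc]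
    refine mul_le_mul' (pow_le_pow_of_le_one (by simp) (by simp) (by nlinarith)) ?_
    calc _ ≤ 2 ^ (k * N) * ∫⁻ y in closedBall x (5 * (1 / 2) ^ k), ENNReal.ofReal (3 * c) := by
          gcongr
          exact hS _ _
      _ = _ := by
          rw [setLIntegral_const, volume_closedBall_RN x (by positivity),
            ← two_pow_mul_ofReal_pow (N := N) k (by norm_num : (0 : ℝ) ≤ 5)]
          ring
  have hz : ∀ k x, x ∉ closedBall (0 : RN N) (R + 6) → tailAvg φ L f k x = 0 := by
    intro k x hx
    rw [mem_closedBall, not_le] at hx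
    refine ENNReal.tsum_eq_zero.2 fun n => ?_
    rw [setLIntegral_congr_fun (g := fun _ => 0) measurableSet_closedBall]
    · simp
    · intro y hy
      rw [mem_closedBall, dist_comm] at hy
      have h1 : (1 / 2 : ℝ) ^ k ≤ 1 := pow_le_one₀ (by norm_num) (by norm_num)
      have h2 : (1 / 2 : ℝ) ^ (k + n) ≤ 1 := pow_le_one₀ (by norm_num) (by norm_num)
      have h3 := dist_triangle x y 0
      simp only [enorm_eq_zero]
      exact smoothing_eq_zero hφ.supp (by positivity) hf0 (by linarith)
  refine ⟨(2 * (ENNReal.ofReal 5 ^ N * vb * ENNReal.ofReal (3 * c))) ^ p *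
    volume (closedBall (0 : RN N) (R + 6)), ?_, fun k => ?_⟩
  · refine ENNReal.mul_ne_top (ENNReal.rpow_ne_top_of_nonneg hp0.le ?_)
      measure_closedBall_lt_top.ne
    finiteness
  · rw [← setLIntegral_const, ← lintegral_indicator measurableSet_closedBall]
    refine lintegral_mono fun x => ?_
    by_cases hx : x ∈ closedBall (0 : RN N) (R + 6)
    · rw [indicator_of_mem hx]
      exact ENNReal.rpow_le_rpow (hle k x) hp0.le
    · rw [indicator_of_notMem hx, hz k x hx, ENNReal.zero_rpow_of_pos hp0]

lemma half_pow_rpow_le {p : ℝ} {L : ℕ} (hL : (N : ℝ) + 1 ≤ L * p) (n : ℕ) :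
    ((2⁻¹ : ℝ≥0∞) ^ (L * n)) ^ p ≤ 2⁻¹ ^ n * 2⁻¹ ^ (n * N) := by
  rw [← pow_add, ← ENNReal.rpow_natCast, ← ENNReal.rpow_natCast, ← ENNReal.rpow_mul]
  refine ENNReal.rpow_le_rpow_of_exponent_ge (by simp) ?_
  push_cast
  nlinarith [Nat.cast_nonneg (α := ℝ) n]

include hφ hf hfc in
lemma lintegral_tailAvg_rpow_le_tsum {p : ℝ} (hp0 : 0 < p) (hp1 : p < 1) {L : ℕ}
    (hL : (N : ℝ) + 1 ≤ L * p) {C : ℝ≥0∞}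
    (hC : ∀ (k : ℕ), ∀ x z : RN N, dist z x ≤ (1 / 2) ^ k →
      ‖smoothing φ ((1 / 2) ^ k) f z‖ₑ ≤ C * tailAvg φ L f k x)
    {δ : ℝ≥0∞} (hδ0 : δ ≠ 0) (hδ : δ ≠ ⊤) (k : ℕ) :
    ∫⁻ x, tailAvg φ L f k x ^ p ≤ ∑' n : ℕ, 2⁻¹ ^ n *
      (δ ^ p * (C ^ p * ENNReal.ofReal 6 ^ N) * (∫⁻ x, tailAvg φ L f (k + n) x ^ p) +
        δ⁻¹ ^ (1 - p) * (ENNReal.ofReal 5 ^ N * volume (ball (0 : RN N) 1)) *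
          ∫⁻ y, ‖smoothing φ ((1 / 2) ^ (k + n)) f y‖ₑ ^ p) := by
  refine (lintegral_mono (tailAvg_rpow_le hφ hf hfc hp0 hp1 hC hδ0 hδ k)).trans ?_
  set vb := volume (ball (0 : RN N) 1) with hvb
  have hvb0 : vb ≠ 0 := (measure_ball_pos _ _ one_pos).ne'
  have hvb1 : vb ≠ ⊤ := measure_ball_lt_top.ne
  have mT : ∀ j, Measurable fun w => tailAvg φ L f j w ^ p := fun j =>
    (measurable_tailAvg hφ hf hfc L j).pow_const p
  have mS : ∀ j : ℕ, Measurable fun w => ‖smoothing φ ((1 / 2) ^ j) f w‖ₑ ^ p := fun j =>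
    (measurable_enorm_smoothing hφ hf hfc _).pow_const p
  have m1 := fun j => (measurable_lintegral_closedBall (mT j) (6 * (1 / 2) ^ k))
  have m2 := fun j => (measurable_lintegral_closedBall (mS j) (5 * (1 / 2) ^ k))
  have m3 := fun n => ((m1 (k + n)).const_mul (C ^ p)).const_mul (2 ^ ((k + n) * N) * vb⁻¹)
  have m4 := fun n => ((m2 (k + n)).const_mul (2 ^ (k * N)))
  have m5 := fun n => ((m3 n).const_mul (δ ^ p)).fun_add ((m4 n).const_mul (δ⁻¹ ^ (1 - p)))
  rw [lintegral_tsum fun n => ((m5 n).const_mul _).aemeasurable]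
  refine ENNReal.tsum_le_tsum fun n => ?_
  rw [lintegral_const_mul _ (m5 n),
    lintegral_add_left ((m3 n).const_mul _), lintegral_const_mul _ (m3 n),
    lintegral_const_mul _ (m4 n), lintegral_const_mul _ ((m1 _).const_mul _),
    lintegral_const_mul _ (m1 _), lintegral_const_mul _ (m2 _),
    lintegral_lintegral_closedBall (mT _) (by positivity),
    lintegral_lintegral_closedBall (mS _) (by positivity), ← hvb]
  have e5 := two_pow_mul_ofReal_pow (N := N) k (c := 5) (by norm_num)
  have e6 := two_pow_mul_ofReal_pow (N := N) k (c := 6) (by norm_num)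
  generalize ENNReal.ofReal (5 * (1 / 2) ^ k) ^ N = a5 at *
  generalize ENNReal.ofReal (6 * (1 / 2) ^ k) ^ N = a6 at *
  generalize ∫⁻ x, tailAvg φ L f (k + n) x ^ p = J
  generalize ∫⁻ y, ‖smoothing φ ((1 / 2) ^ (k + n)) f y‖ₑ ^ p = Q
  rw [← e5, ← e6, add_mul, pow_add, mul_add, mul_add]
  have hcancel : (2⁻¹ : ℝ≥0∞) ^ (n * N) * 2 ^ (n * N) = 1 := by
    rw [mul_comm, two_pow_mul_half_pow]
  refine add_le_add ?_ ?_
  · calc _ ≤ 2⁻¹ ^ n * 2⁻¹ ^ (n * N) * (δ ^ p * (2 ^ (k * N) * 2 ^ (n * N) * vb⁻¹ *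
          (C ^ p * (a6 * vb * J)))) := by gcongr; exact half_pow_rpow_le hL n
      _ = 2⁻¹ ^ n * (δ ^ p * (C ^ p * (2 ^ (k * N) * a6)) * J) *
          (2⁻¹ ^ (n * N) * 2 ^ (n * N)) * (vb⁻¹ * vb) := by ring
      _ = _ := by rw [hcancel, ENNReal.inv_mul_cancel hvb0 hvb1, mul_one, mul_one]
  · calc _ ≤ 2⁻¹ ^ n * 2⁻¹ ^ (n * N) * (δ⁻¹ ^ (1 - p) * (2 ^ (k * N) * (a5 * vb * Q))) := by
          gcongr; exact half_pow_rpow_le hL n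
      _ ≤ 2⁻¹ ^ n * 1 * (δ⁻¹ ^ (1 - p) * (2 ^ (k * N) * (a5 * vb * Q))) := by
          gcongr; exact pow_le_one₀ (by simp) (by simp)
      _ = _ := by ring

include hφ in
lemma exists_lintegral_tailAvg_le {p : ℝ} (hp0 : 0 < p) (hp1 : p < 1) {L : ℕ} (hL1 : 1 ≤ L)
    (hL : (N : ℝ) + 1 ≤ L * p) :
    ∃ A : ℝ≥0∞, A ≠ ⊤ ∧ ∀ f : RN N → ℂ, ContDiff ℝ ∞ f → HasCompactSupport f → ∀ k,
      ∫⁻ x, tailAvg φ L f (k + 1) x ^ p ≤ A * ∫⁻ x, smallMax φ f x ^ p := by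
  obtain ⟨C, hC, hCb⟩ := norm_smoothing_le_tailAvg hφ hφ.smooth hφ.supp hL1
  have hCp : C ^ p ≠ ⊤ := ENNReal.rpow_ne_top_of_nonneg hp0.le hC
  set B := C ^ p * ENNReal.ofReal 6 ^ N with hB
  have hBt : B ≠ ⊤ := by finiteness
  set δ := (4 * (B + 1))⁻¹ ^ (1 / p) with hδd
  have hδp : δ ^ p = (4 * (B + 1))⁻¹ := by
    rw [hδd, ← ENNReal.rpow_mul, one_div_mul_cancel hp0.ne', ENNReal.rpow_one]
  have h40 : 4 * (B + 1) ≠ 0 := by simp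
  have h4t : 4 * (B + 1) ≠ ⊤ := by finiteness
  have hδ0 : δ ≠ 0 := fun h => by
    rw [h, ENNReal.zero_rpow_of_pos hp0] at hδp
    exact h4t (ENNReal.inv_eq_zero.1 hδp.symm)
  have hδt : δ ≠ ⊤ := ENNReal.rpow_ne_top_of_nonneg (by positivity) (by simp)
  set E := δ⁻¹ ^ (1 - p) * (ENNReal.ofReal 5 ^ N * volume (ball (0 : RN N) 1)) with hE
  have hEt : E ≠ ⊤ := by
    have h1 : δ⁻¹ ^ (1 - p) ≠ ⊤ :=
      ENNReal.rpow_ne_top_of_nonneg (by linarith) (ENNReal.inv_ne_top.2 hδ0)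
    have h2 : volume (ball (0 : RN N) 1) ≠ ⊤ := measure_ball_lt_top.ne
    finiteness
  have hB4 : 2 * (δ ^ p * B) ≤ 2⁻¹ := by
    have h1 : 2 * (δ ^ p * B) * 2 ≤ 1 := by
      calc 2 * (δ ^ p * B) * 2 = (4 * (B + 1))⁻¹ * (4 * B) := by rw [hδp]; ring
        _ ≤ (4 * (B + 1))⁻¹ * (4 * (B + 1)) := by gcongr; exact le_self_add
        _ = 1 := ENNReal.inv_mul_cancel h40 h4t
    rw [← one_div, ENNReal.le_div_iff_mul_le (by simp) (by simp)]
    exact h1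
  refine ⟨2 * (2 * E), by finiteness, fun f hf hfc k => ?_⟩
  set Q := ∫⁻ x, smallMax φ f x ^ p
  obtain ⟨M, hM, hMb⟩ := exists_lintegral_tailAvg_bound hφ hf hfc hp0 hL1
  set J := ⨆ k, ∫⁻ x, tailAvg φ L f (k + 1) x ^ p with hJ
  have hJt : J ≠ ⊤ := ne_top_of_le_ne_top hM (iSup_le fun k => hMb _)
  have hmain : J ≤ 2⁻¹ * J + 2 * E * Q := by
    refine iSup_le fun k => ?_
    refine (lintegral_tailAvg_rpow_le_tsum hφ hf hfc hp0 hp1 hL (fun k x z hz =>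
      hCb k _ le_rfl (by linarith [pow_pos (half_pos one_pos : (0:ℝ) < 1 / 2) k]) f hf hfc x z hz)
      hδ0 hδt (k + 1)).trans ?_
    calc _ ≤ ∑' n : ℕ, 2⁻¹ ^ n * (δ ^ p * B * J + E * Q) := by
          refine ENNReal.tsum_le_tsum fun n => ?_
          gcongr
          · rw [hJ, add_right_comm]
            exact le_iSup (fun k => ∫⁻ x, tailAvg φ L f (k + 1) x ^ p) (k + n)
          · refine lintegral_mono fun x => ENNReal.rpow_le_rpow
              (enorm_smoothing_le_smallMax ⟨by positivity, ?_⟩ φ f x) hp0.le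
            exact pow_lt_one₀ (by norm_num) (by norm_num) (by omega)
      _ = 2 * (δ ^ p * B) * J + 2 * E * Q := by
          rw [ENNReal.tsum_mul_right, tsum_half_pow]; ring
      _ ≤ _ := by gcongr
  have h2 : 2⁻¹ * J ≤ 2 * E * Q := by
    have h3 : 2⁻¹ * J + 2⁻¹ * J ≤ 2⁻¹ * J + 2 * E * Q := by
      rwa [← add_mul, ENNReal.inv_two_add_inv_two, one_mul]
    exact (ENNReal.add_le_add_iff_left (by finiteness)).1 h3
  calc _ ≤ J := le_iSup (fun k => ∫⁻ x, tailAvg φ L f (k + 1) x ^ p) k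
    _ = 2 * (2⁻¹ * J) := by
      rw [← mul_assoc, ENNReal.mul_inv_cancel (by simp) (by simp), one_mul]
    _ ≤ 2 * (2 * E * Q) := by gcongr
    _ = _ := by ring

end TailAverageIntegral

section Gradient

lemma pd_contDiff {u : RN N → ℂ} (hu : ContDiff ℝ ∞ u) (i : Fin N) : ContDiff ℝ ∞ (pd i u) :=
  (hu.fderiv_right (by simp)).clm_apply contDiff_const

lemma tsupport_pd_subset (u : RN N → ℂ) (i : Fin N) : tsupport (pd i u) ⊆ tsupport u :=
  (tsupport_fderiv_apply_subset ℝ _)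

lemma pd_hasCompactSupport {u : RN N → ℂ} (hc : HasCompactSupport u) (i : Fin N) :
    HasCompactSupport (pd i u) :=
  hc.of_isClosed_subset (isClosed_tsupport _) (tsupport_pd_subset u i)

lemma eq_zero_of_lt_dist {u : RN N → ℂ} {x₀ : RN N} {ρ : ℝ} (hs : tsupport u ⊆ ball x₀ ρ)
    {y : RN N} (hy : ρ < dist y x₀) : u y = 0 :=
  image_eq_zero_of_notMem_tsupport fun h => by
    have := hs h
    rw [mem_ball] at this
    linarith

lemma fderiv_apply_eq_sum_pd (u : RN N → ℂ) (y z : RN N) :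
    fderiv ℝ u y z = ∑ i, z i • pd i u y := by
  conv_lhs => rw [← (EuclideanSpace.basisFun (Fin N) ℝ).sum_repr z]
  simp [pd]

lemma pd_smoothing {ψ : RN N → ℝ} (hψ : ContDiff ℝ ∞ ψ) {u : RN N → ℂ} (hu : ContDiff ℝ ∞ u)
    (hc : HasCompactSupport u) (t : ℝ) (i : Fin N) :
    pd i (smoothing ψ t u) = smoothing ψ t (pd i u) := by
  ext x
  unfold pd
  rw [(smoothing_hasFDerivAt hψ hu hc x).fderiv, smoothing_apply, smoothing_apply,
    ContinuousLinearMap.integral_apply]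
  · rfl
  · refine Continuous.integrable_of_hasCompactSupport ?_ ?_
    · exact ((dil_contDiff hψ t).continuous.comp (continuous_const.sub continuous_id)).smul
        (hu.continuous_fderiv (by simp))
    · exact HasCompactSupport.smul_left (f := fun y => dil ψ t (x - y)) (hc.fderiv ℝ)

lemma enorm_le_lintegral_pd {g : RN N → ℂ} (hg : ContDiff ℝ ∞ g) {x₀ : RN N} {R : ℝ} (hR : 0 < R)
    (hz : ∀ x, R < dist x x₀ → g x = 0) (i : Fin N) (x : RN N) :
    ‖g x‖ₑ ≤ ∫⁻ s in Ioc 0 (2 * R + 1), ‖pd i g (x + s • EuclideanSpace.single i (1 : ℝ))‖ₑ := by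
  by_cases hx : R < dist x x₀
  · simp [hz x hx]
  rw [not_lt] at hx
  set e : RN N := EuclideanSpace.single i (1 : ℝ)
  have he : ‖e‖ = 1 := by simp [e]
  have hd : ∀ s : ℝ, HasDerivAt (fun s : ℝ => g (x + s • e)) (pd i g (x + s • e)) s := by
    intro s
    have h1 : HasDerivAt (fun s : ℝ => x + s • e) e s := by
      simpa using ((hasDerivAt_id s).smul_const e).const_add x
    exact ((hg.differentiable (by simp)) (x + s • e)).hasFDerivAt.comp_hasDerivAt s h1
  have hcont : Continuous fun s : ℝ => pd i g (x + s • e) :=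
    (pd_contDiff hg i).continuous.comp (by fun_prop)
  have h0 : g (x + (2 * R + 1) • e) = 0 := by
    refine hz _ ?_
    have h1 := dist_triangle_left (x + (2 * R + 1) • e) x x₀
    have h2 : dist x (x + (2 * R + 1) • e) = 2 * R + 1 := by
      rw [dist_self_add_right, norm_smul, he, Real.norm_of_nonneg (by positivity), mul_one]
    have h3 := dist_triangle_right x (x + (2 * R + 1) • e) x₀
    linarith
  have h1 := intervalIntegral.integral_eq_sub_of_hasDerivAt (a := 0) (b := 2 * R + 1)
    (fun s _ => hd s) (hcont.intervalIntegrable _ _)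
  rw [h0, zero_smul, add_zero, zero_sub, intervalIntegral.integral_of_le (by positivity)] at h1
  rw [← enorm_neg, ← h1]
  exact enorm_integral_le_lintegral_enorm _

variable {φ : RN N → ℝ} (hφ : GoodPhi φ) {u : RN N → ℂ} (hu : ContDiff ℝ ∞ u)
  (hc : HasCompactSupport u)

include hφ hu hc in
lemma enorm_smoothing_le_lintegral_pd {x₀ : RN N} {ρ : ℝ} (hρ : 0 < ρ)
    (hs : tsupport u ⊆ ball x₀ ρ) {t : ℝ} (ht : t ∈ Ioo (0 : ℝ) 1) (i : Fin N) (x : RN N) :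
    ‖smoothing φ t u x‖ₑ ≤ ∫⁻ s in Ioc 0 (2 * (ρ + 1) + 1),
      ‖smoothing φ t (pd i u) (x + s • EuclideanSpace.single i (1 : ℝ))‖ₑ := by
  rw [← pd_smoothing hφ.smooth hu hc]
  refine enorm_le_lintegral_pd (smoothing_contDiff hφ.smooth hu hc) (x₀ := x₀) (by positivity)
    (fun z hz => ?_) i x
  exact smoothing_eq_zero hφ.supp ht.1 (fun y => eq_zero_of_lt_dist hs) (by linarith [ht.2])

include hφ hu hc in
lemma measurable_smallMax : Measurable (smallMax φ u) := by
  unfold smallMax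
  refine (lowerSemicontinuous_biSup fun t ht => ?_).measurable
  rw [convAt_eq_smoothing]
  exact (ENNReal.continuous_ofReal.comp
    (smoothing_contDiff hφ.smooth hu hc).continuous.norm).lowerSemicontinuous

include hφ hu hc in
lemma smallMax_le_lintegral_pd {x₀ : RN N} {ρ : ℝ} (hρ : 0 < ρ)
    (hs : tsupport u ⊆ ball x₀ ρ) (i : Fin N) (x : RN N) :
    smallMax φ u x ≤ ∫⁻ s in Ioc 0 (2 * (ρ + 1) + 1),
      smallMax φ (pd i u) (x + s • EuclideanSpace.single i (1 : ℝ)) := by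
  refine iSup₂_le fun t ht => ?_
  rw [ofReal_norm, convAt_eq_smoothing]
  refine (enorm_smoothing_le_lintegral_pd hφ hu hc hρ hs ht i x).trans ?_
  exact lintegral_mono fun s => enorm_smoothing_le_smallMax ht φ _ _

lemma rpow_lintegral_le {X : Type*} [MeasurableSpace X] {μ : Measure X} {p : ℝ} (hp : 1 ≤ p)
    {g : X → ℝ≥0∞} (hg : AEMeasurable g μ) :
    (∫⁻ s, g s ∂μ) ^ p ≤ μ univ ^ (p - 1) * ∫⁻ s, g s ^ p ∂μ := by
  have hp0 : 0 < p := by linarith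
  have h := eLpNorm'_le_eLpNorm'_mul_rpow_measure_univ (μ := μ) one_pos hp hg.aestronglyMeasurable
  simp only [eLpNorm', enorm_eq_self, ENNReal.rpow_one, div_one] at h
  calc _ ≤ ((∫⁻ s, g s ^ p ∂μ) ^ (1 / p) * μ univ ^ (1 - 1 / p)) ^ p := by gcongr
    _ = _ := by
      rw [ENNReal.mul_rpow_of_nonneg _ _ hp0.le, ← ENNReal.rpow_mul, ← ENNReal.rpow_mul,
        one_div_mul_cancel hp0.ne', ENNReal.rpow_one, sub_mul, one_mul,
        one_div_mul_cancel hp0.ne', mul_comm]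

include hφ hu hc in
lemma lintegral_smallMax_le_of_one_le {p : ℝ} (hp : 1 ≤ p) {x₀ : RN N} {ρ : ℝ} (hρ : 0 < ρ)
    (hs : tsupport u ⊆ ball x₀ ρ) (i : Fin N) :
    ∫⁻ x, smallMax φ u x ^ p ≤
      ENNReal.ofReal (2 * (ρ + 1) + 1) ^ p * ∫⁻ x, smallMax φ (pd i u) x ^ p := by
  set Λ := 2 * (ρ + 1) + 1 with hΛ
  have hΛ0 : 0 < Λ := by positivity
  set e : RN N := EuclideanSpace.single i (1 : ℝ)
  have hm := measurable_smallMax hφ (pd_contDiff hu i) (pd_hasCompactSupport hc i)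
  have hadd : Measurable fun q : RN N × ℝ => q.1 + q.2 • e := by fun_prop
  calc ∫⁻ x, smallMax φ u x ^ p
      ≤ ∫⁻ x, ENNReal.ofReal Λ ^ (p - 1) *
          ∫⁻ s in Ioc 0 Λ, smallMax φ (pd i u) (x + s • e) ^ p := by
        refine lintegral_mono fun x => ?_
        refine (ENNReal.rpow_le_rpow (smallMax_le_lintegral_pd hφ hu hc hρ hs i x)
          (by linarith)).trans ?_
        refine (rpow_lintegral_le hp ((hm.comp
          (hadd.comp measurable_prodMk_left)).aemeasurable)).trans ?_
        simp [hΛ]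
    _ = ENNReal.ofReal Λ ^ (p - 1) *
          ∫⁻ s in Ioc 0 Λ, ∫⁻ x, smallMax φ (pd i u) (x + s • e) ^ p := by
        rw [lintegral_const_mul, lintegral_lintegral_swap]
        · exact ((hm.comp hadd).pow_const p).aemeasurable
        · exact ((hm.comp hadd).pow_const p).lintegral_prod_right'
    _ = ENNReal.ofReal Λ ^ (p - 1) *
          (ENNReal.ofReal Λ * ∫⁻ x, smallMax φ (pd i u) x ^ p) := by
        congr 1
        simp_rw [fun s : ℝ => lintegral_add_right_eq_self (μ := (volume : Measure (RN N)))
          (fun x => smallMax φ (pd i u) x ^ p) (s • e)]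
        rw [setLIntegral_const, Real.volume_Ioc, sub_zero, mul_comm]
    _ = _ := by
        rw [← mul_assoc]
        congr 1
        nth_rewrite 2 [← ENNReal.rpow_one (ENNReal.ofReal Λ)]
        rw [← ENNReal.rpow_add_of_nonneg _ _ (by linarith) zero_le_one, sub_add_cancel]

end Gradient

section ScaleDerivative

lemma smoothing_eq_integral_smul (ψ : RN N → ℝ) {t : ℝ} (ht : 0 < t) (g : RN N → ℂ) (x : RN N) :
    smoothing ψ t g x = ∫ z, ψ z • g (x - t • z) := by
  have h := Measure.integral_comp_inv_smul_of_nonneg (volume : Measure (RN N))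
    (fun z => ψ z • g (x - t • z)) ht.le
  rw [smoothing_apply, ← integral_sub_left_eq_self (fun y => dil ψ t (x - y) • g y) volume x]
  simp only [smul_inv_smul₀ ht.ne', finrank_euclideanSpace, Fintype.card_fin] at h
  have h2 : ∀ y, dil ψ t (x - (x - y)) • g (x - y) =
      (t ^ N)⁻¹ • (ψ (t⁻¹ • y) • g (x - y)) := by
    intro y
    rw [sub_sub_cancel, dil, smul_smul, div_eq_inv_mul]
  simp_rw [h2]
  rw [integral_smul, h, smul_smul, inv_mul_cancel₀ (by positivity), one_smul]

variable {φ : RN N → ℝ} (hφ : GoodPhi φ)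

include hφ in
lemma coord_mul_contDiff (i : Fin N) : ContDiff ℝ ∞ fun z : RN N => z i * φ z :=
  (EuclideanSpace.proj (𝕜 := ℝ) i).contDiff.mul hφ.smooth

include hφ in
lemma tsupport_coord_mul_subset (i : Fin N) :
    tsupport (fun z : RN N => z i * φ z) ⊆ closedBall 0 1 :=
  (tsupport_mul_subset_right (f := fun z : RN N => z i)).trans hφ.supp

include hφ in
lemma hasCompactSupport_of_goodPhi : HasCompactSupport φ :=
  (isCompact_closedBall 0 1).of_isClosed_subset (isClosed_tsupport _) hφ.supp

variable {u : RN N → ℂ} (hu : ContDiff ℝ ∞ u) (hc : HasCompactSupport u)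

include hφ hu hc in
lemma hasDerivAt_smoothing_scale (x : RN N) {t : ℝ} (ht : 0 < t) :
    HasDerivAt (fun s => smoothing φ s u x)
      (-∑ i, smoothing (fun z => z i * φ z) t (pd i u) x) t := by
  have hφc := hasCompactSupport_of_goodPhi hφ
  obtain ⟨c, hcb⟩ := (hc.fderiv ℝ).exists_bound_of_continuous (hu.continuous_fderiv (by simp))
  have hφ0 : ∀ z, 1 < ‖z‖ → φ z = 0 := fun z hz =>
    image_eq_zero_of_notMem_tsupport fun h => by
      have := hφ.supp h
      rw [mem_closedBall_zero_iff] at this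
      linarith
  have hcd : Continuous (fderiv ℝ u) := hu.continuous_fderiv (by simp)
  have hcu := hu.continuous
  have hcφ := hφ.smooth.continuous
  have hsub : ∀ s : ℝ, Continuous fun z : RN N => x - s • z := fun s => by fun_prop
  have key := (hasDerivAt_integral_of_dominated_loc_of_deriv_le (μ := (volume : Measure (RN N)))
    (F := fun s z => φ z • u (x - s • z)) (x₀ := t) (s := univ)
    (F' := fun s z => φ z • -(fderiv ℝ u (x - s • z) z)) (bound := fun z => φ z * c)
    univ_mem (Eventually.of_forall fun s =>
      (hcφ.smul (hcu.comp (hsub s))).aestronglyMeasurable)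
    ((hcφ.smul (hcu.comp (hsub t))).integrable_of_hasCompactSupport hφc.smul_right)
    (hcφ.smul ((hcd.comp (hsub t)).clm_apply continuous_id).neg).aestronglyMeasurable
    (Eventually.of_forall fun z s _ => ?_)
    ((hcφ.mul continuous_const).integrable_of_hasCompactSupport hφc.mul_right)
    (Eventually.of_forall fun z s _ => ?_)).2
  · have h2 : ∫ z, φ z • -(fderiv ℝ u (x - t • z) z) =
        -∑ i, smoothing (fun z => z i * φ z) t (pd i u) x := by
      simp_rw [fun i => smoothing_eq_integral_smul (fun z : RN N => z i * φ z) ht (pd i u) x]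
      rw [← integral_finsetSum, ← integral_neg]
      · refine integral_congr_ae (Eventually.of_forall fun z => ?_)
        simp only [smul_neg, fderiv_apply_eq_sum_pd u, Finset.smul_sum, smul_smul, mul_comm]
      · intro i _
        exact ((coord_mul_contDiff hφ i).continuous.smul
          ((pd_contDiff hu i).continuous.comp (hsub t))).integrable_of_hasCompactSupport
          (hφc.mul_left (f := fun z : RN N => z i)).smul_right
    rw [← h2]
    refine key.congr_of_eventuallyEq ?_
    filter_upwards [lt_mem_nhds ht] with s hs
    exact smoothing_eq_integral_smul φ hs u x
  · rw [norm_smul, norm_neg, Real.norm_of_nonneg (hφ.nonneg z)]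
    by_cases hz : 1 < ‖z‖
    · simp [hφ0 z hz]
    · refine mul_le_mul_of_nonneg_left ?_ (hφ.nonneg z)
      refine ((fderiv ℝ u (x - s • z)).le_opNorm z).trans ?_
      have h0 : 0 ≤ c := (norm_nonneg _).trans (hcb x)
      have := hcb (x - s • z)
      nlinarith [norm_nonneg z]
  · have h1 : HasDerivAt (fun s : ℝ => x - s • z) (-z) s := by
      simpa using ((hasDerivAt_id s).smul_const z).const_sub x
    have h2 := ((hu.differentiable (by simp)) (x - s • z)).hasFDerivAt.comp_hasDerivAt s h1
    rw [map_neg] at h2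
    exact h2.const_smul (φ z)

include hφ in
lemma exists_enorm_sub_smoothing_le {L : ℕ} (hL : 1 ≤ L) :
    ∃ C : ℝ≥0∞, C ≠ ⊤ ∧ ∀ u : RN N → ℂ, ContDiff ℝ ∞ u → HasCompactSupport u →
      ∀ (k : ℕ) (x : RN N), ∀ s ∈ Icc ((1 / 2 : ℝ) ^ k) (2 * (1 / 2) ^ k),
      ∀ t ∈ Icc ((1 / 2 : ℝ) ^ k) (2 * (1 / 2) ^ k),
        ‖smoothing φ t u x - smoothing φ s u x‖ₑ ≤
          2⁻¹ ^ k * (C * ∑ i, tailAvg φ L (pd i u) k x) := by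
  choose C hCt hC using fun i => norm_smoothing_le_tailAvg hφ (coord_mul_contDiff hφ i)
    (tsupport_coord_mul_subset hφ i) hL
  refine ⟨∑ i, C i, ENNReal.sum_ne_top.2 fun i _ => hCt i, fun u hu hc k x s hs t ht => ?_⟩
  set X := (∑ i, C i) * ∑ i, tailAvg φ L (pd i u) k x with hX
  have h0 : (0 : ℝ) < (1 / 2) ^ k := by positivity
  by_cases hXt : X = ⊤
  · rw [hXt, ENNReal.mul_top (by simp)]
    exact le_top
  have hder : ∀ r ∈ Icc ((1 / 2 : ℝ) ^ k) (2 * (1 / 2) ^ k),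
      ‖-∑ i, smoothing (fun z => z i * φ z) r (pd i u) x‖ ≤ X.toReal := by
    intro r hr
    rw [← ENNReal.ofReal_le_iff_le_toReal hXt, ofReal_norm, enorm_neg]
    refine (enorm_sum_le _ _).trans ?_
    rw [hX, Finset.mul_sum]
    refine Finset.sum_le_sum fun i _ => ?_
    refine (hC i k r hr.1 hr.2 (pd i u) (pd_contDiff hu i) (pd_hasCompactSupport hc i) x x
      (by simp)).trans ?_
    gcongr
    exact Finset.single_le_sum (f := C) (fun _ _ => zero_le) (Finset.mem_univ i)
  have hmv := (convex_Icc _ _).norm_image_sub_le_of_norm_hasDerivWithin_le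
    (fun r hr => (hasDerivAt_smoothing_scale hφ hu hc x (h0.trans_le hr.1)).hasDerivWithinAt)
    hder hs ht
  rw [← ofReal_norm]
  refine (ENNReal.ofReal_le_ofReal hmv).trans ?_
  rw [ENNReal.ofReal_mul ENNReal.toReal_nonneg, ENNReal.ofReal_toReal hXt, mul_comm,
    ← ofReal_half_pow]
  gcongr
  rw [Real.norm_eq_abs, abs_le]
  constructor <;> linarith [hs.1, hs.2, ht.1, ht.2]

include hφ in
lemma exists_smallMax_le_tailAvg {L : ℕ} (hL : 1 ≤ L) :
    ∃ C : ℝ≥0∞, C ≠ ⊤ ∧ ∀ u : RN N → ℂ, ContDiff ℝ ∞ u → HasCompactSupport u → ∀ x,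
      smallMax φ u x ≤ ‖smoothing φ (1 / 2) u x‖ₑ +
        ∑' k, 2⁻¹ ^ (k + 1) * (C * ∑ i, tailAvg φ L (pd i u) (k + 1) x) := by
  obtain ⟨C, hCt, hC⟩ := exists_enorm_sub_smoothing_le hφ hL
  refine ⟨C, hCt, fun u hu hc x => iSup₂_le fun t ht => ?_⟩
  rw [ofReal_norm, convAt_eq_smoothing]
  set b : ℕ → ℝ≥0∞ := fun k => 2⁻¹ ^ (k + 1) * (C * ∑ i, tailAvg φ L (pd i u) (k + 1) x)
  have hind : ∀ k : ℕ, ∀ t ∈ Icc ((1 / 2 : ℝ) ^ (k + 1)) ((1 / 2) ^ k),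
      ‖smoothing φ t u x‖ₑ ≤ ‖smoothing φ (1 / 2) u x‖ₑ + ∑ j ∈ Finset.range (k + 1), b j := by
    have hstep : ∀ k : ℕ, ∀ t ∈ Icc ((1 / 2 : ℝ) ^ (k + 1)) ((1 / 2) ^ k),
        ∀ s ∈ Icc ((1 / 2 : ℝ) ^ (k + 1)) ((1 / 2) ^ k),
        ‖smoothing φ t u x‖ₑ ≤ ‖smoothing φ s u x‖ₑ + b k := by
      intro k t ht s hs
      have e : (1 / 2 : ℝ) ^ k = 2 * (1 / 2) ^ (k + 1) := by ring
      rw [e] at ht hs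
      refine le_trans ?_ (add_le_add_right (hC u hu hc (k + 1) x s hs t ht) _)
      refine le_trans (le_of_eq ?_) (enorm_add_le _ _)
      rw [add_sub_cancel]
    intro k
    induction k with
    | zero =>
      intro t ht
      simpa using hstep 0 t ht (1 / 2) ⟨by norm_num, by norm_num⟩
    | succ k ih =>
      intro t ht
      have hle : ∀ j : ℕ, (1 / 2 : ℝ) ^ (j + 1) ≤ (1 / 2) ^ j := fun j =>
        pow_le_pow_of_le_one (by norm_num) (by norm_num) (by omega)
      refine (hstep (k + 1) t ht ((1 / 2) ^ (k + 1)) ⟨hle _, le_rfl⟩).trans ?_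
      rw [Finset.sum_range_succ _ (k + 1), ← add_assoc]
      gcongr
      exact ih _ ⟨le_rfl, hle _⟩
  obtain ⟨k, hk1, hk2⟩ := exists_nat_pow_near_of_lt_one ht.1 ht.2.le
    (by norm_num : (0 : ℝ) < 1 / 2) (by norm_num)
  refine (hind k t ⟨hk1.le, hk2⟩).trans ?_
  gcongr
  exact ENNReal.sum_le_tsum _

end ScaleDerivative

section SmallExponent

variable {φ : RN N → ℝ} (hφ : GoodPhi φ)

include hφ in
lemma exists_enorm_smoothing_half_rpow_le {p : ℝ} (hp0 : 0 < p) (hp1 : p < 1) {L : ℕ}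
    (hL1 : 1 ≤ L) (hL : (N : ℝ) + 1 ≤ L * p) :
    ∃ A : ℝ≥0∞, A ≠ ⊤ ∧ ∀ f : RN N → ℂ, ContDiff ℝ ∞ f → HasCompactSupport f → ∀ y,
      ‖smoothing φ (1 / 2) f y‖ₑ ^ p ≤ A * ∫⁻ x, smallMax φ f x ^ p := by
  obtain ⟨C, hCt, hC⟩ := norm_smoothing_le_tailAvg hφ hφ.smooth hφ.supp hL1
  obtain ⟨A, hAt, hA⟩ := exists_lintegral_tailAvg_le hφ hp0 hp1 hL1 hL
  set v := 2⁻¹ ^ (1 * N) * volume (ball (0 : RN N) 1) with hv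
  have hv0 : v ≠ 0 := mul_ne_zero (by simp) (measure_ball_pos _ _ one_pos).ne'
  have hvt : v ≠ ⊤ := ENNReal.mul_ne_top (by finiteness) measure_ball_lt_top.ne
  refine ⟨v⁻¹ * (C ^ p * A), ENNReal.mul_ne_top (ENNReal.inv_ne_top.2 hv0)
    (ENNReal.mul_ne_top (ENNReal.rpow_ne_top_of_nonneg hp0.le hCt) hAt), fun f hf hfc y => ?_⟩
  have h := enorm_smoothing_rpow_mul_le hφ hf hfc hp0 (fun k x z hz =>
      hC k _ le_rfl (by linarith [pow_pos (half_pos one_pos : (0 : ℝ) < 1 / 2) k]) f hf hfc x z hz)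
      1 y
  rw [← hv, pow_one] at h
  calc _ = v⁻¹ * (v * ‖smoothing φ (1 / 2) f y‖ₑ ^ p) := by
        rw [← mul_assoc, ENNReal.inv_mul_cancel hv0 hvt, one_mul]
    _ ≤ v⁻¹ * (C ^ p * ∫⁻ x, tailAvg φ L f (0 + 1) x ^ p) := by
        refine mul_le_mul_right (h.trans ?_) _
        gcongr
        exact Measure.restrict_le_self
    _ ≤ v⁻¹ * (C ^ p * (A * ∫⁻ x, smallMax φ f x ^ p)) := by
        gcongr
        exact hA f hf hfc 0
    _ = _ := by ring

include hφ in
lemma exists_lintegral_smoothing_half_le {p : ℝ} (hp0 : 0 < p) (hp1 : p < 1) {L : ℕ}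
    (hL1 : 1 ≤ L) (hL : (N : ℝ) + 1 ≤ L * p) (x₀ : RN N) {ρ : ℝ} (hρ : 0 < ρ) (i : Fin N) :
    ∃ A : ℝ≥0∞, A ≠ ⊤ ∧ ∀ u : RN N → ℂ, ContDiff ℝ ∞ u → HasCompactSupport u →
      tsupport u ⊆ ball x₀ ρ →
      ∫⁻ x, ‖smoothing φ (1 / 2) u x‖ₑ ^ p ≤ A * ∫⁻ x, smallMax φ (pd i u) x ^ p := by
  obtain ⟨A, hAt, hA⟩ := exists_enorm_smoothing_half_rpow_le hφ hp0 hp1 hL1 hL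
  set Λ := 2 * (ρ + 1) + 1 with hΛ
  refine ⟨A * ENNReal.ofReal Λ ^ p * volume (closedBall x₀ (ρ + 1)), ENNReal.mul_ne_top
    (ENNReal.mul_ne_top hAt (ENNReal.rpow_ne_top_of_nonneg hp0.le ENNReal.ofReal_ne_top))
    measure_closedBall_lt_top.ne, fun u hu hc hs => ?_⟩
  set Q := ∫⁻ x, smallMax φ (pd i u) x ^ p
  have hpt : ∀ x, ‖smoothing φ (1 / 2) u x‖ₑ ^ p ≤ A * Q * ENNReal.ofReal Λ ^ p := by
    intro x
    have hb : ∀ y, ‖smoothing φ (1 / 2) (pd i u) y‖ₑ ≤ (A * Q) ^ (1 / p) := fun y => by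
      rw [one_div p, ENNReal.le_rpow_inv_iff hp0]
      exact hA _ (pd_contDiff hu i) (pd_hasCompactSupport hc i) y
    calc _ ≤ (∫⁻ s in Ioc 0 Λ, (A * Q) ^ (1 / p)) ^ p := by
          refine ENNReal.rpow_le_rpow ((enorm_smoothing_le_lintegral_pd hφ hu hc hρ hs
            ⟨by norm_num, by norm_num⟩ i x).trans (lintegral_mono fun s => hb _)) hp0.le
      _ = _ := by
          rw [setLIntegral_const, Real.volume_Ioc, sub_zero, ENNReal.mul_rpow_of_nonneg _ _ hp0.le,
            ← ENNReal.rpow_mul, one_div_mul_cancel hp0.ne', ENNReal.rpow_one]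
  calc _ ≤ ∫⁻ x in closedBall x₀ (ρ + 1), A * Q * ENNReal.ofReal Λ ^ p := by
        rw [← lintegral_indicator measurableSet_closedBall]
        refine lintegral_mono fun x => ?_
        by_cases hx : x ∈ closedBall x₀ (ρ + 1)
        · rw [indicator_of_mem hx]
          exact hpt x
        · rw [mem_closedBall, not_le] at hx
          rw [smoothing_eq_zero hφ.supp (by norm_num) (fun y => eq_zero_of_lt_dist hs)
            (by linarith), enorm_zero, ENNReal.zero_rpow_of_pos hp0]
          exact zero_le
    _ = _ := by
        rw [setLIntegral_const]
        ring

lemma ennreal_sum_rpow_le {ι : Type*} (s : Finset ι) {p : ℝ} (hp0 : 0 < p) (hp1 : p ≤ 1)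
    (a : ι → ℝ≥0∞) : (∑ i ∈ s, a i) ^ p ≤ ∑ i ∈ s, a i ^ p := by
  classical
  induction s using Finset.induction_on with
  | empty => simp [hp0]
  | insert i s hi ih =>
    rw [Finset.sum_insert hi, Finset.sum_insert hi]
    exact (ENNReal.rpow_add_le_add_rpow _ _ hp0.le hp1).trans (by gcongr)

include hφ in
lemma exists_lintegral_smallMax_le_of_lt_one {p : ℝ} (hp0 : 0 < p) (hp1 : p < 1) (x₀ : RN N)
    {ρ : ℝ} (hρ : 0 < ρ) (i₀ : Fin N) :
    ∃ A : ℝ≥0∞, A ≠ ⊤ ∧ ∀ u : RN N → ℂ, ContDiff ℝ ∞ u → HasCompactSupport u →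
      tsupport u ⊆ ball x₀ ρ →
      ∫⁻ x, smallMax φ u x ^ p ≤ A * ∑ i, ∫⁻ x, smallMax φ (pd i u) x ^ p := by
  obtain ⟨L, hL⟩ : ∃ L : ℕ, (N : ℝ) + 1 ≤ L * p := by
    obtain ⟨L, hL⟩ := exists_nat_ge (((N : ℝ) + 1) / p)
    exact ⟨L, (div_le_iff₀ hp0).1 hL⟩
  have hL1 : 1 ≤ L := by
    rw [Nat.one_le_iff_ne_zero]
    rintro rfl
    rw [Nat.cast_zero, zero_mul] at hL
    linarith [Nat.cast_nonneg (α := ℝ) N]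
  obtain ⟨A₀, hA₀t, hA₀⟩ := exists_lintegral_smoothing_half_le hφ hp0 hp1 hL1 hL x₀ hρ i₀
  obtain ⟨A₁, hA₁t, hA₁⟩ := exists_lintegral_tailAvg_le hφ hp0 hp1 hL1 hL
  obtain ⟨C, hCt, hC⟩ := exists_smallMax_le_tailAvg hφ hL1
  have hCpt : C ^ p ≠ ⊤ := ENNReal.rpow_ne_top_of_nonneg hp0.le hCt
  set G : ℝ≥0∞ := ∑' k : ℕ, (2⁻¹ ^ (k + 1)) ^ p with hG
  have hGt : G ≠ ⊤ := by
    have h1 : (2⁻¹ : ℝ≥0∞) ^ p < 1 := ENNReal.rpow_lt_one (by simp) hp0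
    have h2 : ∀ k : ℕ, ((2⁻¹ : ℝ≥0∞) ^ (k + 1)) ^ p = (2⁻¹ ^ p) ^ k * 2⁻¹ ^ p := fun k => by
      rw [← pow_succ, ← ENNReal.rpow_natCast, ← ENNReal.rpow_natCast, ← ENNReal.rpow_mul,
        ← ENNReal.rpow_mul, mul_comm]
    rw [hG]
    simp_rw [h2]
    rw [ENNReal.tsum_mul_right, ENNReal.tsum_geometric]
    exact ENNReal.mul_ne_top (ENNReal.inv_ne_top.2 (tsub_pos_of_lt h1).ne')
      (h1.trans ENNReal.one_lt_top).ne
  refine ⟨A₀ + G * (C ^ p * A₁), by finiteness, fun u hu hc hs => ?_⟩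
  have hpu := fun i => pd_contDiff hu i
  have hpc := fun i => pd_hasCompactSupport hc i
  have mT : ∀ k i, Measurable fun x => tailAvg φ L (pd i u) (k + 1) x ^ p := fun k i =>
    (measurable_tailAvg hφ (hpu i) (hpc i) L (k + 1)).pow_const p
  have mS : ∀ k, Measurable fun x => ∑ i, tailAvg φ L (pd i u) (k + 1) x ^ p := fun k =>
    Finset.measurable_fun_sum _ fun i _ => mT k i
  have hpt : ∀ x, smallMax φ u x ^ p ≤ ‖smoothing φ (1 / 2) u x‖ₑ ^ p +
      ∑' k : ℕ, (2⁻¹ ^ (k + 1)) ^ p * (C ^ p * ∑ i, tailAvg φ L (pd i u) (k + 1) x ^ p) := by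
    intro x
    refine (ENNReal.rpow_le_rpow (hC u hu hc x) hp0.le).trans ?_
    refine (ENNReal.rpow_add_le_add_rpow _ _ hp0.le hp1.le).trans ?_
    refine add_le_add_right ((ennreal_tsum_rpow_le hp0 hp1.le _).trans ?_) _
    refine ENNReal.tsum_le_tsum fun k => ?_
    rw [ENNReal.mul_rpow_of_nonneg _ _ hp0.le, ENNReal.mul_rpow_of_nonneg _ _ hp0.le]
    gcongr
    exact ennreal_sum_rpow_le _ hp0 hp1.le _
  refine (lintegral_mono hpt).trans ?_
  rw [lintegral_add_left ((measurable_enorm_smoothing hφ hu hc _).pow_const p), add_mul,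
    lintegral_tsum fun k => (((mS k).const_mul _).const_mul _).aemeasurable]
  refine add_le_add ?_ ?_
  · refine (hA₀ u hu hc hs).trans ?_
    gcongr
    exact Finset.single_le_sum (f := fun i => ∫⁻ x, smallMax φ (pd i u) x ^ p)
      (fun _ _ => zero_le) (Finset.mem_univ i₀)
  · rw [hG, mul_assoc, ← ENNReal.tsum_mul_right]
    refine ENNReal.tsum_le_tsum fun k => ?_
    rw [lintegral_const_mul _ ((mS k).const_mul _), lintegral_const_mul _ (mS k),
      lintegral_finsetSum _ fun i _ => mT k i, mul_assoc]
    refine mul_le_mul_right (mul_le_mul_right ?_ _) _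
    rw [Finset.mul_sum]
    exact Finset.sum_le_sum fun i _ => hA₁ _ (hpu i) (hpc i) k

end SmallExponent

section GradientNorm

variable {φ : RN N → ℝ} (hφ : GoodPhi φ)

include hφ in
lemma exists_hNorm_le_sum_pd {p : ℝ} (hp0 : 0 < p) (x₀ : RN N) {ρ : ℝ} (hρ : 0 < ρ)
    (i₀ : Fin N) :
    ∃ A : ℝ≥0∞, A ≠ ⊤ ∧ ∀ u : RN N → ℂ, ContDiff ℝ ∞ u → HasCompactSupport u →
      tsupport u ⊆ ball x₀ ρ → hNorm φ p u ≤ A * ∑ i, hNorm φ p (pd i u) := by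
  obtain ⟨A, hAt, hA⟩ : ∃ A : ℝ≥0∞, A ≠ ⊤ ∧ ∀ u : RN N → ℂ, ContDiff ℝ ∞ u →
      HasCompactSupport u → tsupport u ⊆ ball x₀ ρ →
      ∫⁻ x, smallMax φ u x ^ p ≤ A * ∑ i, ∫⁻ x, smallMax φ (pd i u) x ^ p := by
    rcases lt_or_ge p 1 with hp1 | hp1
    · exact exists_lintegral_smallMax_le_of_lt_one hφ hp0 hp1 x₀ hρ i₀
    · refine ⟨ENNReal.ofReal (2 * (ρ + 1) + 1) ^ p,
        ENNReal.rpow_ne_top_of_nonneg hp0.le ENNReal.ofReal_ne_top, fun u hu hc hs =>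
        (lintegral_smallMax_le_of_one_le hφ hu hc hp1 hρ hs i₀).trans ?_⟩
      gcongr
      exact Finset.single_le_sum (f := fun i => ∫⁻ x, smallMax φ (pd i u) x ^ p)
        (fun _ _ => zero_le) (Finset.mem_univ i₀)
  refine ⟨(A * N) ^ (1 / p), ENNReal.rpow_ne_top_of_nonneg (by positivity) (by finiteness),
    fun u hu hc hs => ?_⟩
  have hsum : ∑ i, ∫⁻ x, smallMax φ (pd i u) x ^ p ≤ N * (∑ i, hNorm φ p (pd i u)) ^ p := by
    calc _ ≤ ∑ _i : Fin N, (∑ i, hNorm φ p (pd i u)) ^ p := by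
          refine Finset.sum_le_sum fun i _ => ?_
          rw [← ENNReal.rpow_inv_le_iff hp0, ← one_div]
          exact Finset.single_le_sum (f := fun i => hNorm φ p (pd i u))
            (fun _ _ => zero_le) (Finset.mem_univ i)
      _ = _ := by simp
  calc hNorm φ p u ≤ (A * (N * (∑ i, hNorm φ p (pd i u)) ^ p)) ^ (1 / p) := by
        unfold hNorm at hsum ⊢
        gcongr
        exact (hA u hu hc hs).trans (by gcongr)
    _ = _ := by
        rw [← mul_assoc, ENNReal.mul_rpow_of_nonneg _ _ (by positivity), ← ENNReal.rpow_mul,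
          mul_one_div_cancel hp0.ne', ENNReal.rpow_one]

end GradientNorm

section MultiIndex

lemma pd_comm {f : RN N → ℂ} (hf : ContDiff ℝ ∞ f) (i j : Fin N) :
    pd j (pd i f) = pd i (pd j f) := by
  have h2 : (2 : WithTop ℕ∞) ≤ (⊤ : ℕ∞) := 
    WithTop.coe_le_coe.2 (le_top : (2 : ℕ∞) ≤ ⊤)
  have hd : Differentiable ℝ (fderiv ℝ f) := (hf.fderiv_right (m := ∞) (by simp)).differentiable
    (by simp)
  have h : ∀ (v w : RN N) (x : RN N), fderiv ℝ (fun y => fderiv ℝ f y v) x w =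
      fderiv ℝ (fderiv ℝ f) x w v := fun v w x => by
    rw [fderiv_clm_apply (hd x) (differentiableAt_const v)]
    simp
  ext x
  unfold pd
  rw [h, h]
  exact (hf.contDiffAt.isSymmSndFDerivAt (by simpa using h2)) _ _

lemma iterate_pd_contDiff {f : RN N → ℂ} (hf : ContDiff ℝ ∞ f) (i : Fin N) (n : ℕ) :
    ContDiff ℝ ∞ ((pd i)^[n] f) := by
  induction n with
  | zero => exact hf
  | succ n ih =>
    rw [Function.iterate_succ_apply']
    exact pd_contDiff ih i

lemma tsupport_iterate_pd_subset (f : RN N → ℂ) (i : Fin N) (n : ℕ) :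
    tsupport ((pd i)^[n] f) ⊆ tsupport f := by
  induction n with
  | zero => exact Subset.rfl
  | succ n ih =>
    rw [Function.iterate_succ_apply']
    exact (tsupport_pd_subset _ i).trans ih

lemma pd_iterate_pd {f : RN N → ℂ} (hf : ContDiff ℝ ∞ f) (i j : Fin N) (n : ℕ) :
    pd j ((pd i)^[n] f) = (pd i)^[n] (pd j f) := by
  induction n with
  | zero => rfl
  | succ n ih =>
    rw [Function.iterate_succ_apply', Function.iterate_succ_apply', ← ih,
      pd_comm (iterate_pd_contDiff hf i n)]

/-- Iterated partial derivatives taken along the directions in a list. -/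
def listDeriv (l : List (Fin N)) (α : Fin N → ℕ) (f : RN N → ℂ) : RN N → ℂ :=
  l.foldr (fun i g => (pd i)^[α i] g) f

lemma md_eq_listDeriv (α : Fin N → ℕ) (f : RN N → ℂ) :
    md α f = listDeriv (List.finRange N) α f := by
  unfold md listDeriv
  rw [List.ofFn_eq_map]
  induction List.finRange N with
  | nil => rfl
  | cons i l ih =>
    rw [List.map_cons, List.foldr_cons, List.foldr_cons, ← ih]
    rfl

lemma listDeriv_contDiff (l : List (Fin N)) (α : Fin N → ℕ) {f : RN N → ℂ}
    (hf : ContDiff ℝ ∞ f) : ContDiff ℝ ∞ (listDeriv l α f) := by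
  induction l with
  | nil => exact hf
  | cons i l ih => exact iterate_pd_contDiff ih i _

lemma tsupport_listDeriv_subset (l : List (Fin N)) (α : Fin N → ℕ) (f : RN N → ℂ) :
    tsupport (listDeriv l α f) ⊆ tsupport f := by
  induction l with
  | nil => exact Subset.rfl
  | cons i l ih => exact (tsupport_iterate_pd_subset _ i _).trans ih

lemma listDeriv_update_of_notMem {l : List (Fin N)} {j : Fin N} (hj : j ∉ l) (α : Fin N → ℕ)
    (n : ℕ) (f : RN N → ℂ) : listDeriv l (Function.update α j n) f = listDeriv l α f := by
  induction l with
  | nil => rfl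
  | cons i l ih =>
    rw [List.mem_cons, not_or] at hj
    change (pd i)^[_] (listDeriv l _ f) = (pd i)^[_] (listDeriv l α f)
    rw [ih hj.2, Function.update_of_ne (Ne.symm hj.1)]

lemma pd_listDeriv {l : List (Fin N)} (hl : l.Nodup) {j : Fin N} (hj : j ∈ l) (α : Fin N → ℕ)
    {f : RN N → ℂ} (hf : ContDiff ℝ ∞ f) :
    pd j (listDeriv l α f) = listDeriv l (Function.update α j (α j + 1)) f := by
  induction l with
  | nil => simp at hj
  | cons i l ih =>
    rw [List.nodup_cons] at hl
    change pd j ((pd i)^[_] (listDeriv l α f)) = (pd i)^[_] (listDeriv l _ f)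
    rcases eq_or_ne j i with rfl | hji
    · rw [listDeriv_update_of_notMem hl.1, Function.update_self, Function.iterate_succ_apply']
    · rw [pd_iterate_pd (listDeriv_contDiff l α hf),
        ih hl.2 ((List.mem_cons.1 hj).resolve_left hji), Function.update_of_ne hji.symm]

lemma pd_md (j : Fin N) (α : Fin N → ℕ) {f : RN N → ℂ} (hf : ContDiff ℝ ∞ f) :
    pd j (md α f) = md (Function.update α j (α j + 1)) f := by
  rw [md_eq_listDeriv, md_eq_listDeriv]
  exact pd_listDeriv (List.nodup_finRange N) (List.mem_finRange j) α hf

lemma mOrder_update (α : Fin N → ℕ) (j : Fin N) :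
    mOrder (Function.update α j (α j + 1)) = mOrder α + 1 := by
  unfold mOrder
  rw [Finset.sum_update_of_mem (Finset.mem_univ j), Finset.sdiff_singleton_eq_erase,
    ← Finset.add_sum_erase _ _ (Finset.mem_univ j)]
  omega

lemma mem_idxEq {m : ℕ} {α : Fin N → ℕ} (h : mOrder α = m) : α ∈ idxEq N m := by
  rw [idxEq, Finset.mem_filter, Fintype.mem_piFinset]
  refine ⟨fun i => Finset.mem_range.2 ?_, h⟩
  have : α i ≤ mOrder α := Finset.single_le_sum (fun _ _ => Nat.zero_le _) (Finset.mem_univ i)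
  omega

lemma hNorm_md_le {φ : RN N → ℝ} {p : ℝ} {A : ℝ≥0∞} {x₀ : RN N} {ρ : ℝ}
    (hA : ∀ u : RN N → ℂ, ContDiff ℝ ∞ u → HasCompactSupport u → tsupport u ⊆ ball x₀ ρ →
      hNorm φ p u ≤ A * ∑ i, hNorm φ p (pd i u)) {u : RN N → ℂ} (hu : ContDiff ℝ ∞ u)
    (hc : HasCompactSupport u) (hs : tsupport u ⊆ ball x₀ ρ) (m d : ℕ) :
    ∀ α : Fin N → ℕ, mOrder α + d = m →
      hNorm φ p (md α u) ≤ (A * N) ^ d * ∑ β ∈ idxEq N m, hNorm φ p (md β u) := by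
  induction d with
  | zero =>
    intro α hα
    rw [pow_zero, one_mul]
    exact Finset.single_le_sum (f := fun β => hNorm φ p (md β u)) (fun _ _ => zero_le)
      (mem_idxEq hα)
  | succ d ih =>
    intro α hα
    have hsub : tsupport (md α u) ⊆ tsupport u := by
      rw [md_eq_listDeriv]
      exact tsupport_listDeriv_subset _ _ _
    have hsm : ContDiff ℝ ∞ (md α u) := by
      rw [md_eq_listDeriv]
      exact listDeriv_contDiff _ _ hu
    calc hNorm φ p (md α u) ≤ A * ∑ i, hNorm φ p (pd i (md α u)) :=
          hA _ hsm (hc.of_isClosed_subset (isClosed_tsupport _) hsub) (hsub.trans hs)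
      _ ≤ A * ∑ _i : Fin N, (A * N) ^ d * ∑ β ∈ idxEq N m, hNorm φ p (md β u) := by
          gcongr with i
          rw [pd_md i α hu]
          exact ih _ (by rw [mOrder_update]; omega)
      _ = _ := by
          rw [Finset.sum_const, Finset.card_univ, Fintype.card_fin, nsmul_eq_mul]
          ring

end MultiIndex

end LocalHardyEstimates

/-- Iterated Sobolev–Gagliardo–Nirenberg estimate in `h^p` on a ball (inequality (5.4)). -/
theorem statement9 {N m : ℕ} (hN : 2 ≤ N) (hm : 1 ≤ m) (p : ℝ) (hp0 : 0 < p)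
    (hpN : p < N) (φ₀ : RN N → ℝ) (hφ₀ : GoodPhi φ₀)
    (x₀ : RN N) (ρ : ℝ) (hρ : 0 < ρ) :
    ∃ C : ℝ, 0 < C ∧
      ∀ α : Fin N → ℕ, mOrder α ≤ m →
      ∀ u : RN N → ℂ, ContDiff ℝ (⊤ : ℕ∞) u → HasCompactSupport u →
        tsupport u ⊆ ball x₀ ρ →
        hNorm φ₀ p (md α u) ≤
          ENNReal.ofReal
            (C * (volume (ball x₀ ρ)).toReal ^ (((m : ℝ) - (mOrder α : ℝ)) / N)) *
            ∑ β ∈ idxEq N m, hNorm φ₀ p (md β u) := by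
  obtain ⟨A, hAt, hA⟩ := exists_hNorm_le_sum_pd hφ₀ hp0 x₀ hρ (⟨0, by omega⟩ : Fin N)
  set V := (volume (ball x₀ ρ)).toReal
  have hV : 0 < V := ENNReal.toReal_pos (measure_ball_pos _ _ hρ).ne' measure_ball_lt_top.ne
  set K := (A * N).toReal
  have hKV : ∀ d : ℕ, 0 ≤ K ^ d / V ^ ((d : ℝ) / N) := fun d => by positivity
  refine ⟨1 + ∑ d ∈ Finset.range (m + 1), K ^ d / V ^ ((d : ℝ) / N),
    add_pos_of_pos_of_nonneg one_pos (Finset.sum_nonneg fun d _ => hKV d),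
    fun α hα u hu hc hs => ?_⟩
  obtain ⟨d, hd⟩ := Nat.exists_eq_add_of_le hα
  refine (hNorm_md_le hA hu hc hs m d α hd.symm).trans ?_
  gcongr
  rw [← ENNReal.ofReal_toReal (by finiteness : A * N ≠ ⊤), ← ENNReal.ofReal_pow (by positivity)]
  refine ENNReal.ofReal_le_ofReal ?_
  have hcast : (m : ℝ) - mOrder α = d := by rw [hd]; push_cast; ring
  rw [hcast, ← div_le_iff₀ (by positivity)]
  have h1 := Finset.single_le_sum (f := fun d : ℕ => K ^ d / V ^ ((d : ℝ) / N))
    (fun d _ => hKV d) (Finset.mem_range.2 (by omega : d < m + 1))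
  linarith
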